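/- arXiv:2403.00399 — 2 statements merged into one kernel-verified Lean document; each statement's English description precedes it below -/
import Mathlib

section
/- Let G be a quantitative reachability game in the Pareto setting with vertex set V, t environment target sets T_1,…,T_t, maximum edge weight W, and initial vertex v_0, and let c ∈ ℕ. If there exist a strategy σ_0 of player 0 and a σ_0-fixed Pareto-optimal play π with cost_0(π) ≤ c, then there exist a strategy σ_0′ of player 0 and a σ_0′-fixed Pareto-optimal lasso play π′ = μ(ν)^ω from v_0 with cost_0(π′) ≤ c such that Visit(μ) = Visit(μν), |μ| ≤ (t+1)·|V|, |ν| ≤ |V|, and for every i ∈ {1,…,t}, cost_i(π′) ∈ {0,1,…,(t+2)·|V|·W} ∪ {+∞}. -/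
open scoped Classical

/-- An infinite play in the graph with edge relation `E`. -/
def IsPlay {V : Type*} (E : V → V → Prop) (π : ℕ → V) : Prop :=
  ∀ k, E (π k) (π (k + 1))

/-- The history `π 0, …, π k` as a list. -/
def histList {V : Type*} (π : ℕ → V) (k : ℕ) : List V :=
  (List.range (k + 1)).map π

/-- The accumulated weight of the first `n` edges of `π`. -/
def pathWeight {V : Type*} (w : V → V → ℕ) (π : ℕ → V) (n : ℕ) : ℕ :=
  ∑ j ∈ Finset.range n, w (π j) (π (j + 1))

/-- The cost of a play for weight function `w` and target set `T` : the accumulated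
weight up to the first visit of `T`, and `+∞` if `T` is never visited. -/
noncomputable def cost {V : Type*} (w : V → V → ℕ) (T : Set V) (π : ℕ → V) : ℕ∞ :=
  if h : ∃ n, π n ∈ T then (pathWeight w π (Nat.find h) : ℕ∞) else ⊤

/-- `σ` is a strategy for the player owning the set of vertices `Vi`. -/
def IsStrategy {V : Type*} (E : V → V → Prop) (Vi : Set V) (σ : List V → V) : Prop :=
  ∀ (l : List V) (u : V), List.Chain' E (l ++ [u]) → u ∈ Vi → E u (σ (l ++ [u]))

/-- A play is consistent with the strategy `σ` of the player owning `Vi`. -/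
def PlayConsistent {V : Type*} (Vi : Set V) (σ : List V → V) (π : ℕ → V) : Prop :=
  ∀ k, π k ∈ Vi → π (k + 1) = σ (histList π k)

/-- `π` is a lasso `μ (ν)^ω` where `|μ| = a` and `|ν| = b`. -/
def IsLasso {V : Type*} (π : ℕ → V) (a b : ℕ) : Prop :=
  0 < b ∧ ∀ k, a ≤ k → π (k + b) = π k

/-- The payoff of a play: the tuple of the `t` environment costs, with the
componentwise partial order. -/
noncomputable def pay {V : Type*} {t : ℕ} (w : Fin t → V → V → ℕ) (T : Fin t → Set V)
    (π : ℕ → V) : Fin t → ℕ∞ :=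
  fun i => cost (w i) (T i) π

/-- `π` is `σ0`-fixed Pareto-optimal: no play from `v0` consistent with `σ0` has a
strictly smaller payoff. -/
def ParetoOptimal {V : Type*} {t : ℕ} (E : V → V → Prop) (V0 : Set V) (v0 : V)
    (w : Fin t → V → V → ℕ) (T : Fin t → Set V) (σ0 : List V → V) (π : ℕ → V) : Prop :=
  ¬ ∃ π', IsPlay E π' ∧ π' 0 = v0 ∧ PlayConsistent V0 σ0 π' ∧ pay w T π' < pay w T π

theorem histList_eq_iff {V : Type*} {f g : ℕ → V} {k k' : ℕ} :
    histList f k = histList g k' ↔ k = k' ∧ ∀ r ≤ k, f r = g r := by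
  constructor
  · intro h
    have hk : k = k' := by simpa [histList] using congrArg List.length h
    subst hk
    refine ⟨rfl, fun r hr => ?_⟩
    have := List.map_inj_left.1 h r (by simpa [Nat.lt_succ_iff] using hr)
    exact this
  · rintro ⟨rfl, h⟩
    exact List.map_inj_left.2 fun r hr => h r (by simpa [Nat.lt_succ_iff] using hr)

theorem histList_eq_append {V : Type*} (f : ℕ → V) (k : ℕ) :
    histList f k = (List.range k).map f ++ [f k] := by
  simp [histList, List.range_succ]

theorem IsPlay.isChain_histList {V : Type*} {E : V → V → Prop} {f : ℕ → V}
    (hf : IsPlay E f) (k : ℕ) : List.IsChain E (histList f k) := by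
  rw [List.isChain_iff_getElem]
  intro i hi
  simpa [histList] using hf i

/-- A strategy makes a legal move after every finite prefix of a play. -/
theorem IsStrategy.edge_of_isPlay {V : Type*} {E : V → V → Prop} {V0 : Set V}
    {σ : List V → V} (hσ : IsStrategy E V0 σ) {f : ℕ → V} (hf : IsPlay E f) {k : ℕ}
    (hk : f k ∈ V0) : E (f k) (σ (histList f k)) := by
  have h := hf.isChain_histList k
  rw [histList_eq_append] at h ⊢
  exact hσ _ _ h hk

/-- Follow `π` up to time `n`, then continue like `ρ` from time `j`. -/
def splice {V : Type*} (π ρ : ℕ → V) (n j : ℕ) : ℕ → V :=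
  fun r => if r ≤ n then π r else ρ (r - n + j)

theorem splice_of_le {V : Type*} {π ρ : ℕ → V} {n j r : ℕ} (h : r ≤ n) :
    splice π ρ n j r = π r := if_pos h

theorem splice_add {V : Type*} {π ρ : ℕ → V} {n j : ℕ} (h : ρ j = π n) (s : ℕ) :
    splice π ρ n j (n + s) = ρ (j + s) := by
  unfold splice
  split_ifs with hs
  · obtain rfl : s = 0 := by omega
    simpa using h.symm
  · congr 1; omega

theorem IsPlay.splice {V : Type*} {E : V → V → Prop} {π ρ : ℕ → V} {n j : ℕ}
    (hπ : IsPlay E π) (hρ : IsPlay E ρ) (h : ρ j = π n) : IsPlay E (splice π ρ n j) := by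
  intro r
  rcases lt_or_ge r n with hr | hr
  · rw [splice_of_le hr.le, splice_of_le hr]
    exact hπ r
  · obtain ⟨s, rfl⟩ := Nat.exists_eq_add_of_le hr
    rw [splice_add h, add_assoc, splice_add h]
    exact hρ _

/-- The moves of the strategy that follows `π ∘ φ`, and that after a deviation at time `j`
answers like `σ` does when the history up to `j` is replaced by `π` up to time `φ j`. -/
def Reply {V : Type*} (E : V → V → Prop) (σ : List V → V) (π : ℕ → V) (φ : ℕ → ℕ)
    (h : List V) (v : V) : Prop :=
  (∃ k, h = histList (fun r => π (φ r)) k ∧ v = π (φ (k + 1))) ∨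
  ∃ (ρ : ℕ → V) (j k : ℕ), IsPlay E ρ ∧ (∀ r ≤ j, ρ r = π (φ r)) ∧
    ρ (j + 1) ≠ π (φ (j + 1)) ∧ j < k ∧ h = histList ρ k ∧
    v = σ (histList (splice π ρ (φ j) j) (φ j + (k - j)))

/-- Rerouting a play along a reindexing `φ`: player 0 has a strategy with outcome `π ∘ φ`
such that every deviation at time `j` comes from a `σ`-consistent deviation from `π` at
time `φ j`. -/
theorem exists_strategy_reindex {V : Type*} {E : V → V → Prop} (hE : ∀ u, ∃ v, E u v)
    {V0 : Set V} {σ : List V → V} {π : ℕ → V} {φ : ℕ → ℕ}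
    (hσ : IsStrategy E V0 σ) (hπ : IsPlay E π) (hcon : PlayConsistent V0 σ π)
    (hφ : ∀ r, π (φ (r + 1)) = π (φ r + 1)) :
    ∃ σ' : List V → V, IsStrategy E V0 σ' ∧ PlayConsistent V0 σ' (fun r => π (φ r)) ∧
      ∀ ρ, IsPlay E ρ → ρ 0 = π (φ 0) → PlayConsistent V0 σ' ρ →
        ρ = (fun r => π (φ r)) ∨
        ∃ j, (∀ r ≤ j, ρ r = π (φ r)) ∧ PlayConsistent V0 σ (splice π ρ (φ j) j) := by
  have hex : ∀ h : List V, ∃ v, ((∃ v', Reply E σ π φ h v') → Reply E σ π φ h v) ∧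
      ((¬ ∃ v', Reply E σ π φ h v') → ∀ l u, h = l ++ [u] → E u v) := by
    intro h
    by_cases hr : ∃ v', Reply E σ π φ h v'
    · obtain ⟨v, hv⟩ := hr
      exact ⟨v, fun _ => hv, fun hn => absurd ⟨v, hv⟩ hn⟩
    · rcases List.eq_nil_or_concat h with rfl | ⟨l, u, rfl⟩
      · exact ⟨π 0, fun hh => absurd hh hr, fun _ l u hl => by simp at hl⟩
      · obtain ⟨v, hv⟩ := hE u
        refine ⟨v, fun hh => absurd hh hr, fun _ l' u' hl => ?_⟩
        have : u = u' := by
          simpa using congrArg List.getLast? hl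
        exact this ▸ hv
  choose σ' hσ' hσ'' using hex
  have hfollow : ∀ k, σ' (histList (fun r => π (φ r)) k) = π (φ (k + 1)) := by
    intro k
    rcases hσ' _ ⟨_, Or.inl ⟨k, rfl, rfl⟩⟩ with ⟨k', hk, hv⟩ | ⟨ρ, j, k', -, -, hne, hj, hk, -⟩
    · obtain ⟨rfl, -⟩ := histList_eq_iff.1 hk
      exact hv
    · obtain ⟨rfl, h⟩ := histList_eq_iff.1 hk
      exact absurd (h (j + 1) hj).symm hne
  refine ⟨σ', ?_, fun k _ => (hfollow k).symm, ?_⟩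
  · intro l u hl hu
    by_cases hr : ∃ v', Reply E σ π φ (l ++ [u]) v'
    · rcases hσ' _ hr with ⟨k, hk, hv⟩ | ⟨ρ, j, k, hρ, hag, -, hj, hk, hv⟩
      · rw [histList_eq_append] at hk
        obtain ⟨-, hu'⟩ := List.append_inj' hk rfl
        obtain rfl : u = π (φ k) := by simpa using hu'
        rw [hv, hφ]
        exact hπ _
      · rw [histList_eq_append] at hk
        obtain ⟨-, hu'⟩ := List.append_inj' hk rfl
        obtain rfl : u = ρ k := by simpa using hu'
        have hs : splice π ρ (φ j) j (φ j + (k - j)) = ρ k := by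
          rw [splice_add (hag j le_rfl)]; congr 1; omega
        rw [hv, ← hs]
        exact hσ.edge_of_isPlay (hπ.splice hρ (hag j le_rfl)) (hs ▸ hu)
    · exact hσ'' _ hr _ _ rfl
  · intro ρ hρ h0 hρc
    by_cases heq : ρ = fun r => π (φ r)
    · exact Or.inl heq
    right
    have hdiff : ∃ n, ρ n ≠ π (φ n) := by
      by_contra! hc
      exact heq (funext hc)
    have hspec := Nat.find_spec hdiff
    have hmin := fun r => Nat.find_min (m := r) hdiff
    generalize Nat.find hdiff = n at hspec hmin
    obtain ⟨j, rfl⟩ : ∃ j, n = j + 1 := Nat.exists_eq_succ_of_ne_zero fun h => by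
      subst h; exact hspec h0
    have hag : ∀ r ≤ j, ρ r = π (φ r) := fun r hr => not_not.1 (hmin r (by omega))
    refine ⟨j, hag, fun r hr => ?_⟩
    rcases lt_or_ge r (φ j) with hrj | hrj
    · rw [splice_of_le hrj.le] at hr
      rw [splice_of_le hrj, hcon r hr]
      exact congrArg σ (histList_eq_iff.2 ⟨rfl, fun s hs => (splice_of_le (hs.trans hrj.le)).symm⟩)
    obtain ⟨s, rfl⟩ := Nat.exists_eq_add_of_le hrj
    rw [splice_add (hag j le_rfl)] at hr
    rw [add_assoc, splice_add (hag j le_rfl), ← add_assoc, hρc _ hr]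
    rcases Nat.eq_zero_or_pos s with rfl | hs
    · refine absurd ?_ hspec
      rw [add_zero] at hr
      rw [hρc _ hr, ← hfollow]
      exact congrArg σ' (histList_eq_iff.2 ⟨rfl, hag⟩)
    rcases hσ' _ ⟨_, Or.inr ⟨ρ, j, j + s, hρ, hag, hspec, by omega, rfl, rfl⟩⟩ with
      ⟨k', hk, -⟩ | ⟨ρ', j', k', -, hag', hne', hj', hk, hv⟩
    · exact absurd ((histList_eq_iff.1 hk).2 (j + 1) (by omega)) hspec
    · obtain ⟨rfl, h⟩ := histList_eq_iff.1 hk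
      obtain rfl : j' = j := by
        rcases lt_trichotomy j' j with hlt | rfl | hlt
        · exact absurd ((h _ (by omega)).symm.trans (hag _ hlt)) hne'
        · rfl
        · exact absurd ((h _ (by omega)).trans (hag' _ hlt)) hspec
      rw [hv]
      refine congrArg σ (histList_eq_iff.2 ⟨by omega, fun r hr => ?_⟩)
      unfold splice
      split_ifs
      · rfl
      · exact (h _ (by omega)).symm

theorem cost_eq_pathWeight {V : Type*} {w : V → V → ℕ} {T : Set V} {π : ℕ → V} {n : ℕ}
    (hn : π n ∈ T) (hlt : ∀ k < n, π k ∉ T) : cost w T π = pathWeight w π n := by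
  have h : ∃ n, π n ∈ T := ⟨n, hn⟩
  have : Nat.find h = n := (Nat.find_eq_iff h).2 ⟨hn, hlt⟩
  rw [cost, dif_pos h, this]

theorem cost_eq_top {V : Type*} {w : V → V → ℕ} {T : Set V} {π : ℕ → V}
    (h : ∀ n, π n ∉ T) : cost w T π = ⊤ :=
  dif_neg fun ⟨n, hn⟩ => h n hn

theorem exists_of_cost_ne_top {V : Type*} {w : V → V → ℕ} {T : Set V} {π : ℕ → V}
    (h : cost w T π ≠ ⊤) : ∃ n, π n ∈ T := by
  by_contra! hc
  exact h (cost_eq_top hc)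

theorem cost_ne_top {V : Type*} {w : V → V → ℕ} {T : Set V} {π : ℕ → V}
    (h : ∃ n, π n ∈ T) : cost w T π ≠ ⊤ := by
  rw [cost, dif_pos h]
  exact ENat.natCast_ne_top _

theorem exists_first_visit {V : Type*} {T : Set V} {π : ℕ → V} {N : ℕ}
    (h : ∃ k ≤ N, π k ∈ T) : ∃ n ≤ N, π n ∈ T ∧ ∀ k < n, π k ∉ T := by
  obtain ⟨k, hk, hkT⟩ := h
  have h : ∃ k, π k ∈ T := ⟨k, hkT⟩
  exact ⟨Nat.find h, (Nat.find_min' h hkT).trans hk, Nat.find_spec h, fun _ => Nat.find_min h⟩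

theorem pathWeight_congr {V : Type*} {w : V → V → ℕ} {π ρ : ℕ → V} {n : ℕ}
    (h : ∀ r ≤ n, ρ r = π r) : pathWeight w ρ n = pathWeight w π n := by
  refine Finset.sum_congr rfl fun j hj => ?_
  have := Finset.mem_range.1 hj
  rw [h j (by omega), h (j + 1) (by omega)]

theorem cost_congr {V : Type*} {w : V → V → ℕ} {T : Set V} {π ρ : ℕ → V} {N : ℕ}
    (h : ∀ r ≤ N, ρ r = π r) (hT : ∃ k ≤ N, π k ∈ T) : cost w T ρ = cost w T π := by
  obtain ⟨n, hnN, hn, hlt⟩ := exists_first_visit hT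
  rw [cost_eq_pathWeight hn hlt, cost_eq_pathWeight (n := n) (by rwa [h n hnN]),
    pathWeight_congr fun r hr => h r (hr.trans hnN)]
  intro k hk
  rw [h k (by omega)]
  exact hlt k hk

theorem cost_le_of_visit {V : Type*} {E : V → V → Prop} {w : V → V → ℕ} {T : Set V}
    {π : ℕ → V} {N W : ℕ} (hπ : IsPlay E π) (hW : ∀ u v, E u v → w u v ≤ W)
    (hT : ∃ k ≤ N, π k ∈ T) : cost w T π ≤ (N * W : ℕ) := by
  obtain ⟨n, hnN, hn, hlt⟩ := exists_first_visit hT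
  rw [cost_eq_pathWeight hn hlt, Nat.cast_le]
  calc pathWeight w π n ≤ ∑ _j ∈ Finset.range n, W :=
        Finset.sum_le_sum fun j _ => hW _ _ (hπ j)
    _ = n * W := by simp
    _ ≤ N * W := Nat.mul_le_mul_right _ hnN

/-- The reindexing that skips the `d` steps after time `m`. -/
def skip (m d r : ℕ) : ℕ := if r < m then r else r + d

theorem skip_of_lt {m d r : ℕ} (h : r < m) : skip m d r = r := if_pos h

theorem skip_of_le {m d r : ℕ} (h : m ≤ r) : skip m d r = r + d := if_neg h.not_gt

/-- The weight saved for target `T` by skipping the `d` steps of `π` after time `m`. -/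
noncomputable def savedWeight {V : Type*} (w : V → V → ℕ) (T : Set V) (π : ℕ → V)
    (m d : ℕ) : ℕ :=
  if ∃ k ≤ m, π k ∈ T then 0 else ∑ j ∈ Finset.range d, w (π (m + j)) (π (m + j + 1))

theorem savedWeight_congr {V : Type*} {w : V → V → ℕ} {T : Set V} {π ρ : ℕ → V} {m d : ℕ}
    (h : ∀ r ≤ m + d, ρ r = π r) : savedWeight w T ρ m d = savedWeight w T π m d := by
  have h₁ : (∃ k ≤ m, ρ k ∈ T) ↔ ∃ k ≤ m, π k ∈ T :=
    exists_congr fun k => and_congr_right fun hk => by rw [h k (by omega)]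
  have h₂ : ∑ j ∈ Finset.range d, w (ρ (m + j)) (ρ (m + j + 1)) =
      ∑ j ∈ Finset.range d, w (π (m + j)) (π (m + j + 1)) := by
    refine Finset.sum_congr rfl fun j hj => ?_
    have := Finset.mem_range.1 hj
    rw [h _ (by omega), h _ (by omega)]
  simp only [savedWeight, h₁, h₂]

theorem pathWeight_skip {V : Type*} {w : V → V → ℕ} {π : ℕ → V} {m d : ℕ}
    (hcyc : π (m + d) = π m) (s : ℕ) :
    pathWeight w π (m + d + s) = pathWeight w (fun r => π (skip m d r)) (m + s) +
      ∑ j ∈ Finset.range d, w (π (m + j)) (π (m + j + 1)) := by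
  have h₁ : pathWeight w (fun r => π (skip m d r)) m = pathWeight w π m := by
    refine pathWeight_congr fun r hr => ?_
    rcases hr.lt_or_eq with hr | rfl
    · rw [skip_of_lt hr]
    · rw [skip_of_le le_rfl, hcyc]
  have h₂ : ∀ j, skip m d (m + j) = m + d + j := fun j => by
    rw [skip_of_le (by omega)]; omega
  unfold pathWeight at h₁ ⊢
  rw [Finset.sum_range_add, Finset.sum_range_add, Finset.sum_range_add, h₁]
  simp only [h₂, add_assoc]
  ring

theorem cost_skip {V : Type*} (w : V → V → ℕ) {T : Set V} {π : ℕ → V} {m d : ℕ}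
    (hcyc : π (m + d) = π m) (hT : (∃ k ≤ m + d, π k ∈ T) → ∃ k ≤ m, π k ∈ T) :
    cost w T π = cost w T (fun r => π (skip m d r)) + savedWeight w T π m d := by
  have hag : ∀ r ≤ m, π (skip m d r) = π r := by
    intro r hr
    rcases hr.lt_or_eq with hr | rfl
    · rw [skip_of_lt hr]
    · rw [skip_of_le le_rfl, hcyc]
  by_cases hm : ∃ k ≤ m, π k ∈ T
  · rw [savedWeight, if_pos hm, Nat.cast_zero, add_zero, cost_congr hag hm]
  have hmd : ∀ k ≤ m + d, π k ∉ T := fun k hk hkT => hm (hT ⟨k, hk, hkT⟩)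
  rw [savedWeight, if_neg hm]
  by_cases hv : ∃ n, π n ∈ T
  · obtain ⟨n, hn⟩ := hv
    obtain ⟨n, -, hn, hlt⟩ := exists_first_visit ⟨n, le_rfl, hn⟩
    obtain ⟨s, rfl⟩ : ∃ s, n = m + d + s :=
      Nat.exists_eq_add_of_le (not_lt.1 fun h => hmd n h.le hn)
    rw [cost_eq_pathWeight hn hlt, pathWeight_skip hcyc, Nat.cast_add]
    congr 1
    refine (cost_eq_pathWeight (π := fun r => π (skip m d r)) (n := m + s) ?_ ?_).symm
    · simp only [skip_of_le (Nat.le_add_right m s)]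
      convert hn using 2
      omega
    · intro k hk
      rcases lt_or_ge k m with hkm | hkm
      · simp only [skip_of_lt hkm]
        exact hlt _ (by omega)
      · simp only [skip_of_le hkm]
        exact hlt _ (by omega)
  · push Not at hv
    rw [cost_eq_top hv, cost_eq_top fun n => hv _, top_add]

/-- `π` is the outcome of a `σ`-consistent, Pareto-optimal play of cost at most `c`. -/
structure IsSolution {V : Type*} {t : ℕ} (E : V → V → Prop) (V0 : Set V) (v0 : V)
    (w0 : V → V → ℕ) (T0 : Set V) (w : Fin t → V → V → ℕ) (T : Fin t → Set V) (c : ℕ)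
    (σ : List V → V) (π : ℕ → V) : Prop where
  isStrategy : IsStrategy E V0 σ
  isPlay : IsPlay E π
  start : π 0 = v0
  consistent : PlayConsistent V0 σ π
  optimal : ParetoOptimal E V0 v0 w T σ π
  cost_le : cost w0 T0 π ≤ (c : ℕ∞)

section

variable {V : Type*} {t : ℕ} {E : V → V → Prop} {V0 : Set V} {v0 : V} {w0 : V → V → ℕ}
  {T0 : Set V} {w : Fin t → V → V → ℕ} {T : Fin t → Set V} {c : ℕ} {σ : List V → V}
  {π : ℕ → V}

theorem IsSolution.reindex (hE : ∀ u, ∃ v, E u v)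
    (hs : IsSolution E V0 v0 w0 T0 w T c σ π) {φ : ℕ → ℕ}
    (hφ0 : π (φ 0) = π 0) (hφ : ∀ r, π (φ (r + 1)) = π (φ r + 1))
    (hcost : cost w0 T0 (fun r => π (φ r)) ≤ c)
    (hpay : ∀ ρ j, (∀ r ≤ j, ρ r = π (φ r)) → pay w T ρ < pay w T (fun r => π (φ r)) →
      pay w T (splice π ρ (φ j) j) < pay w T π) :
    ∃ σ', IsSolution E V0 v0 w0 T0 w T c σ' (fun r => π (φ r)) := by
  obtain ⟨σ', hσ', hcon, hdev⟩ :=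
    exists_strategy_reindex hE hs.isStrategy hs.isPlay hs.consistent hφ
  refine ⟨σ', hσ', fun r => ?_, hφ0.trans hs.start, hcon, ?_, hcost⟩
  · rw [hφ]
    exact hs.isPlay _
  · rintro ⟨ρ, hρ, hρ0, hρc, hlt⟩
    rcases hdev ρ hρ (by rw [hρ0, hφ0, hs.start]) hρc with rfl | ⟨j, hag, hc⟩
    · exact lt_irrefl _ hlt
    · refine hs.optimal ⟨_, hs.isPlay.splice hρ (hag j le_rfl), ?_, hc, hpay ρ j hag hlt⟩
      rw [splice_of_le (Nat.zero_le _), hs.start]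

/-- A cycle along which no new target is visited can be removed. -/
theorem IsSolution.skip (hE : ∀ u, ∃ v, E u v)
    (hs : IsSolution E V0 v0 w0 T0 w T c σ π) {m d : ℕ} (hcyc : π (m + d) = π m)
    (hT0 : (∃ k ≤ m + d, π k ∈ T0) → ∃ k ≤ m, π k ∈ T0)
    (hT : ∀ i, (∃ k ≤ m + d, π k ∈ T i) → ∃ k ≤ m, π k ∈ T i) :
    ∃ σ', IsSolution E V0 v0 w0 T0 w T c σ' (fun r => π (skip m d r)) := by
  have hle : pay w T (fun r => π (_root_.skip m d r)) ≤ pay w T π := fun i => by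
    change cost _ _ _ ≤ cost _ _ _
    rw [cost_skip (w i) hcyc (hT i)]
    exact le_self_add
  refine hs.reindex hE ?_ (fun r => ?_) ?_ ?_
  · rcases Nat.eq_zero_or_pos m with rfl | hm
    · rw [skip_of_le le_rfl, zero_add, ← hcyc, zero_add]
    · rw [skip_of_lt hm]
  · rcases lt_trichotomy (r + 1) m with h | rfl | h
    · rw [skip_of_lt h, skip_of_lt (by omega)]
    · rw [skip_of_le le_rfl, skip_of_lt (by omega), hcyc]
    · rw [skip_of_le (by omega), skip_of_le (by omega)]
      congr 1; omega
  · refine le_trans ?_ hs.cost_le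
    rw [cost_skip w0 hcyc hT0]
    exact le_self_add
  · intro ρ j hag hlt
    rcases lt_or_ge j m with hj | hj
    · have : splice π ρ (_root_.skip m d j) j = ρ := by
        funext r
        rw [skip_of_lt hj]
        unfold splice
        split_ifs with hr
        · rw [hag r hr, skip_of_lt (by omega)]
        · congr 1; omega
      rw [this]
      exact hlt.trans_le hle
    · rw [skip_of_le hj]
      have hj' : ρ j = π (j + d) := by rw [hag j le_rfl, skip_of_le hj]
      have hag' : ∀ r ≤ m + d, splice π ρ (j + d) j r = π r := fun r hr =>
        splice_of_le (by omega)
      have hρ : (fun r => splice π ρ (j + d) j (_root_.skip m d r)) = ρ := by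
        funext r
        rcases lt_or_ge j r with hr | hr
        · obtain ⟨s, rfl⟩ := Nat.exists_eq_add_of_le hr.le
          rw [skip_of_le (by omega), ← splice_add hj' s]
          congr 1; omega
        · rw [hag r hr, splice_of_le]
          unfold _root_.skip
          split_ifs <;> omega
      have hvis : ∀ i n, n ≤ m + d → ((∃ k ≤ n, splice π ρ (j + d) j k ∈ T i) ↔
          ∃ k ≤ n, π k ∈ T i) := fun i n hn =>
        exists_congr fun k => and_congr_right fun hk => by rw [hag' k (by omega)]
      have key : ∀ i, cost (w i) (T i) (splice π ρ (j + d) j) =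
          cost (w i) (T i) ρ + savedWeight (w i) (T i) π m d := fun i => by
        have hvi := hT i
        rw [← hvis i _ le_rfl, ← hvis i m (by omega)] at hvi
        rw [cost_skip (w i) (by rw [hag' _ le_rfl, hag' m (by omega), hcyc]) hvi, hρ,
          savedWeight_congr hag']
      rw [Pi.lt_def] at hlt ⊢
      obtain ⟨hall, i, hi⟩ := hlt
      refine ⟨fun i => ?_, i, ?_⟩
      · change cost _ _ _ ≤ cost _ _ _
        rw [key, cost_skip (w i) hcyc (hT i)]
        exact add_le_add_left (hall i) _
      · change cost _ _ _ < cost _ _ _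
        rw [key, cost_skip (w i) hcyc (hT i)]
        exact (ENat.add_lt_add_iff_right (ENat.natCast_ne_top _)).2 hi

end

/-- The reindexing that repeats the `b` steps after time `p` forever. -/
def wind (p b r : ℕ) : ℕ := if r < p then r else p + (r - p) % b

theorem wind_of_lt {p b r : ℕ} (h : r < p + b) : wind p b r = r := by
  unfold wind
  split_ifs with hr
  · rfl
  · rw [Nat.mod_eq_of_lt (by omega)]; omega

theorem le_wind {p b r : ℕ} (h : p ≤ r) : p ≤ wind p b r := by
  rw [wind, if_neg h.not_gt]
  exact Nat.le_add_right _ _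

theorem wind_add {p b r : ℕ} (h : p ≤ r) : wind p b (r + b) = wind p b r := by
  rw [wind, wind, if_neg (by omega), if_neg h.not_gt, Nat.sub_add_comm h, Nat.add_mod_right]

theorem wind_succ {p b : ℕ} (hb : 0 < b) (r : ℕ) :
    wind p b (r + 1) = wind p b r + 1 ∨
      wind p b (r + 1) = p ∧ wind p b r + 1 = p + b := by
  rcases lt_or_ge (r + 1) (p + b) with h | h
  · left
    rw [wind_of_lt h, wind_of_lt (by omega)]
  · have hr : p ≤ r := by omega
    rw [wind, wind, if_neg (by omega), if_neg hr.not_gt, Nat.sub_add_comm hr]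
    have hlt := Nat.mod_lt (r - p) hb
    rcases (Nat.succ_le_of_lt hlt).lt_or_eq with h1 | h1
    · left
      rw [Nat.add_mod, Nat.mod_eq_of_lt (a := 1) (by omega), Nat.mod_eq_of_lt h1, add_assoc]
    · right
      have h1' : (r - p) % b + 1 = b := h1
      refine ⟨?_, by omega⟩
      rw [← Nat.mod_add_mod, h1', Nat.mod_self, add_zero]

/-- All targets in the family `S` that `π` ever visits are visited by time `N`. -/
def CompleteAt {V ι : Type*} (S : ι → Set V) (π : ℕ → V) (N : ℕ) : Prop :=
  ∀ o, (∃ k, π k ∈ S o) → ∃ k ≤ N, π k ∈ S o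

theorem exists_completeAt {V ι : Type*} [Finite ι] (S : ι → Set V) (π : ℕ → V) :
    ∃ N, CompleteAt S π N := by
  have h : ∀ o, ∃ n, (∃ k, π k ∈ S o) → π n ∈ S o := fun o => by
    by_cases ho : ∃ k, π k ∈ S o
    · exact ho.imp fun _ hk _ => hk
    · exact ⟨0, fun h => absurd h ho⟩
  choose n hn using h
  obtain ⟨N, hN⟩ := (Set.finite_range n).bddAbove
  exact ⟨N, fun o ho => ⟨n o, hN ⟨o, rfl⟩, hn o ho⟩⟩

theorem CompleteAt.skip {V ι : Type*} {S : ι → Set V} {π : ℕ → V} {N m d : ℕ}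
    (h : CompleteAt S π N) (hmd : m + d ≤ N) (hcyc : π (m + d) = π m)
    (hS : ∀ o, (∃ k ≤ m + d, π k ∈ S o) → ∃ k ≤ m, π k ∈ S o) :
    CompleteAt S (fun r => π (skip m d r)) (N - d) := by
  rintro o ⟨l, hl⟩
  obtain ⟨k, hkN, hk⟩ := h o ⟨_, hl⟩
  rcases le_or_gt k (m + d) with hkm | hkm
  · obtain ⟨n, hnm, hn⟩ := hS o ⟨k, hkm, hk⟩
    refine ⟨n, by omega, ?_⟩
    rcases hnm.lt_or_eq with hlt | rfl
    · simpa only [skip_of_lt hlt] using hn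
    · simpa only [skip_of_le le_rfl, hcyc] using hn
  · refine ⟨k - d, by omega, ?_⟩
    simpa only [skip_of_le (show m ≤ k - d by omega), show k - d + d = k by omega] using hk

/-- In a play without removable cycles before the time `N` of the last first visit, some vertex
repeats early enough to close a lasso. -/
theorem exists_repetition {V ι : Type*} [Fintype V] [Fintype ι] {t : ℕ}
    (hι : Fintype.card ι = t + 1) {S : ι → Set V} {π : ℕ → V} {N : ℕ}
    (hN : CompleteAt S π N) (hmin : ∀ M, CompleteAt S π M → N ≤ M)
    (hcyc : ∀ m d, 0 < d → m + d ≤ N → π (m + d) = π m →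
      ¬ ∀ o, (∃ k ≤ m + d, π k ∈ S o) → ∃ k ≤ m, π k ∈ S o) :
    ∃ p q, p < q ∧ N < q ∧ q ≤ (t + 1) * Fintype.card V ∧ q - p ≤ Fintype.card V ∧
      π p = π q ∧ (N ≤ p ∨ ∀ o, ∃ k, π k ∈ S o) := by
  let vis : ℕ → Finset ι := fun r => Finset.univ.filter fun o => ∃ k ≤ r, π k ∈ S o
  have mem_vis : ∀ r o, o ∈ vis r ↔ ∃ k ≤ r, π k ∈ S o := fun r o => by simp [vis]
  have vis_mono : ∀ {r s}, r ≤ s → vis r ⊆ vis s := fun {r s} hrs o ho => by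
    obtain ⟨k, hk, hkS⟩ := (mem_vis _ _).1 ho
    exact (mem_vis _ _).2 ⟨k, hk.trans hrs, hkS⟩
  let lev : ℕ → ℕ := fun r => min (vis r).card t
  have lev_mono : ∀ {r s}, r ≤ s → lev r ≤ lev s := fun hrs =>
    min_le_min_right _ (Finset.card_le_card (vis_mono hrs))
  let f : ℕ → V × ℕ := fun r => (π r, lev r)
  have f_mem : ∀ r, f r ∈ (Finset.univ : Finset V) ×ˢ Finset.range (t + 1) := fun r => by
    simp [f, lev]
  have hrep : ∃ q, ∃ p < q, f p = f q := by
    obtain ⟨x, -, y, -, hxy, hf⟩ := Set.infinite_univ.exists_ne_map_eq_of_mapsTo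
      (fun r _ => f_mem r) (Finset.finite_toSet _)
    rcases hxy.lt_or_gt with h | h
    · exact ⟨y, x, h, hf⟩
    · exact ⟨x, y, h, hf.symm⟩
  have hspec := Nat.find_spec hrep
  have hfirst := fun r => Nat.find_min (m := r) hrep
  generalize Nat.find hrep = q at hspec hfirst
  obtain ⟨p, hpq, hf⟩ := hspec
  have hπ : π p = π q := congrArg Prod.fst hf
  have hlev : lev p = lev q := congrArg Prod.snd hf
  have hinj : ∀ a b, a < q → b < q → f a = f b → a = b := fun a b ha hb hab => by
    rcases lt_trichotomy a b with h | h | h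
    · exact absurd ⟨a, h, hab⟩ (hfirst b hb)
    · exact h
    · exact absurd ⟨b, h, hab.symm⟩ (hfirst a ha)
  have hq : q ≤ (t + 1) * Fintype.card V := by
    have := Finset.card_le_card_of_injOn (s := Finset.range q) f (fun r _ => f_mem r)
      fun a ha b hb => hinj a b (by simpa using ha) (by simpa using hb)
    simpa [mul_comm] using this
  have hb : q - p ≤ Fintype.card V := by
    have := Finset.card_le_card_of_injOn (s := Finset.Ico p q) (t := Finset.univ) π
      (fun r _ => Finset.mem_univ _) fun a ha b hb hab => by
        obtain ⟨ha1, ha2⟩ := Finset.mem_Ico.1 ha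
        obtain ⟨hb1, hb2⟩ := Finset.mem_Ico.1 hb
        refine hinj a b ha2 hb2 (Prod.ext hab ?_)
        have := lev_mono ha1
        have := lev_mono hb1
        have := lev_mono ha2.le
        have := lev_mono hb2.le
        change lev a = lev b
        omega
    simpa using this
  have hcase : vis p = vis q ∨ vis q = Finset.univ := by
    by_cases hc : (vis q).card ≤ (vis p).card
    · exact Or.inl (Finset.eq_of_subset_of_card_le (vis_mono hpq.le) hc)
    · right
      rw [← Finset.card_eq_iff_eq_univ, hι]
      have := Finset.card_le_univ (vis q)
      have hlev' : min (vis p).card t = min (vis q).card t := hlev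
      omega
  have hNq : N < q := by
    by_contra! hqN
    rcases hcase with h | h
    · refine hcyc p (q - p) (by omega) (by omega) (by rw [hπ]; congr 1; omega) fun o ho => ?_
      rw [show p + (q - p) = q by omega, ← mem_vis, ← h, mem_vis] at ho
      exact ho
    · obtain rfl : q = N := le_antisymm hqN (hmin q fun o _ =>
        (mem_vis q o).1 (h ▸ Finset.mem_univ o))
      have hnot : ¬ CompleteAt S π (q - 1) := fun h => by
        have := hmin _ h
        omega
      unfold CompleteAt at hnot
      push Not at hnot
      obtain ⟨o, ho, hno⟩ := hnot
      obtain ⟨k, hk, hkS⟩ := hN o ho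
      obtain rfl : k = q := by
        by_contra hne
        exact hno k (by omega) hkS
      exact hno p (by omega) (hπ ▸ hkS)
  refine ⟨p, q, hpq, hNq, hq, hb, hπ, ?_⟩
  rcases hcase with h | h
  · left
    refine hmin p fun o ho => ?_
    obtain ⟨k, hk, hkS⟩ := hN o ho
    rw [← mem_vis, h, mem_vis]
    exact ⟨k, by omega, hkS⟩
  · right
    intro o
    obtain ⟨k, -, hk⟩ := (mem_vis q o).1 (h ▸ Finset.mem_univ o)
    exact ⟨k, hk⟩

section

variable {V : Type*} {t : ℕ} {E : V → V → Prop} {V0 : Set V} {v0 : V} {w0 : V → V → ℕ}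
  {T0 : Set V} {w : Fin t → V → V → ℕ} {T : Fin t → Set V} {c : ℕ} {σ : List V → V}
  {π : ℕ → V}

/-- A solution can be closed into a lasso at a repeated vertex after the last first visit, provided
the loop starts after that visit or no target is left to visit. -/
theorem IsSolution.wind (hE : ∀ u, ∃ v, E u v)
    (hs : IsSolution E V0 v0 w0 T0 w T c σ π) {N p b : ℕ} (hb : 0 < b) (hN : N < p + b)
    (hT0 : (∃ k, π k ∈ T0) → ∃ k ≤ N, π k ∈ T0)
    (hT : ∀ i, (∃ k, π k ∈ T i) → ∃ k ≤ N, π k ∈ T i)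
    (hπ : π p = π (p + b)) (hcase : N ≤ p ∨ ∀ i, ∃ k, π k ∈ T i) :
    ∃ σ', IsSolution E V0 v0 w0 T0 w T c σ' (fun r => π (wind p b r)) := by
  have hag : ∀ r ≤ N, π (_root_.wind p b r) = π r := fun r hr => by
    rw [wind_of_lt (by omega)]
  have hcost : ∀ (w : V → V → ℕ) (T : Set V), ((∃ k, π k ∈ T) → ∃ k ≤ N, π k ∈ T) →
      cost w T (fun r => π (_root_.wind p b r)) = cost w T π := fun w T hT => by
    by_cases hv : ∃ k, π k ∈ T
    · exact cost_congr hag (hT hv)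
    · push Not at hv
      rw [cost_eq_top hv, cost_eq_top fun n => hv _]
  have hpay : pay w T (fun r => π (_root_.wind p b r)) = pay w T π :=
    funext fun i => hcost _ _ (hT i)
  refine hs.reindex hE ?_ (fun r => ?_) ((hcost _ _ hT0).trans_le hs.cost_le) ?_
  · exact hag 0 (Nat.zero_le _)
  · rcases wind_succ (p := p) hb r with h | ⟨h, h'⟩
    · rw [h]
    · rw [h, h', hπ]
  · intro ρ j hρ hlt
    rw [hpay] at hlt
    rcases lt_or_ge j (p + b) with hj | hj
    · have : splice π ρ (_root_.wind p b j) j = ρ := by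
        funext r
        rw [wind_of_lt hj]
        unfold splice
        split_ifs with hr
        · rw [hρ r hr, wind_of_lt (by omega)]
        · congr 1; omega
      rwa [this]
    · obtain ⟨-, i, hi⟩ := Pi.lt_def.1 hlt
      change cost _ _ _ < cost _ _ _ at hi
      have hunv : ¬ ∃ k, π k ∈ T i := fun hv =>
        hi.ne (cost_congr (fun r hr => by rw [hρ r (by omega), hag r hr]) (hT i hv))
      have hNp : N ≤ p := hcase.resolve_right fun h => hunv (h i)
      have hNj : N ≤ _root_.wind p b j := hNp.trans (le_wind (by omega))
      rw [Pi.lt_def]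
      refine ⟨fun i' => ?_, i, ?_⟩
      · change cost _ _ _ ≤ cost _ _ _
        by_cases hv : ∃ k, π k ∈ T i'
        · exact (cost_congr (fun r hr => splice_of_le (hr.trans hNj)) (hT i' hv)).le
        · push Not at hv
          rw [cost_eq_top hv]
          exact le_top
      · change cost _ _ _ < cost _ _ _
        obtain ⟨n, hn⟩ := exists_of_cost_ne_top (hi.trans_le le_top).ne
        push Not at hunv
        rw [cost_eq_top hunv]
        refine lt_top_iff_ne_top.2 (cost_ne_top ?_)
        rcases le_or_gt n j with hnj | hnj
        · exact absurd (hρ n hnj ▸ hn) (hunv _)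
        · refine ⟨_root_.wind p b j + (n - j), ?_⟩
          rw [splice_add (hρ j le_rfl), show j + (n - j) = n by omega]
          exact hn

end

/-- If there are a strategy `σ0` of player 0 and a `σ0`-fixed Pareto-optimal play `π`
with `cost₀ π ≤ c`, then there are a strategy `σ0'` and a `σ0'`-fixed Pareto-optimal
lasso play `π' = μ (ν)^ω` with `cost₀ π' ≤ c`, `Visit(μ) = Visit(μν)`,
`|μ| ≤ (t+1)|V|`, `|ν| ≤ |V|`, and each environment cost of `π'` is `+∞` or
at most `(t+2)·|V|·W`. -/
theorem pareto_lasso_le {V : Type*} [Fintype V] (E : V → V → Prop)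
    (hE : ∀ u, ∃ v, E u v) (V0 : Set V) (v0 : V) (t : ℕ)
    (w0 : V → V → ℕ) (T0 : Set V) (w : Fin t → V → V → ℕ) (T : Fin t → Set V)
    (W : ℕ) (hW0 : ∀ u v, E u v → w0 u v ≤ W) (hW : ∀ i u v, E u v → w i u v ≤ W)
    (c : ℕ)
    (h : ∃ (σ0 : List V → V) (π : ℕ → V), IsStrategy E V0 σ0 ∧ IsPlay E π ∧ π 0 = v0 ∧
      PlayConsistent V0 σ0 π ∧ ParetoOptimal E V0 v0 w T σ0 π ∧
      cost w0 T0 π ≤ (c : ℕ∞)) :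
    ∃ (σ0' : List V → V) (π' : ℕ → V) (a b : ℕ),
      IsStrategy E V0 σ0' ∧ IsPlay E π' ∧ π' 0 = v0 ∧
      PlayConsistent V0 σ0' π' ∧ ParetoOptimal E V0 v0 w T σ0' π' ∧
      cost w0 T0 π' ≤ (c : ℕ∞) ∧
      IsLasso π' a b ∧ a ≤ (t + 1) * Fintype.card V ∧ b ≤ Fintype.card V ∧
      ((∃ k < a, π' k ∈ T0) ↔ ∃ k < a + b, π' k ∈ T0) ∧
      (∀ i : Fin t, (∃ k < a, π' k ∈ T i) ↔ ∃ k < a + b, π' k ∈ T i) ∧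
      (∀ i : Fin t, cost (w i) (T i) π' = ⊤ ∨
        cost (w i) (T i) π' ≤ ((t + 2) * Fintype.card V * W : ℕ)) := by
  let S : Option (Fin t) → Set V := fun o => o.elim T0 T
  have hex : ∃ N, ∃ σ π, IsSolution E V0 v0 w0 T0 w T c σ π ∧ CompleteAt S π N := by
    obtain ⟨σ, π, h₁, h₂, h₃, h₄, h₅, h₆⟩ := h
    obtain ⟨N, hN⟩ := exists_completeAt S π
    exact ⟨N, σ, π, ⟨h₁, h₂, h₃, h₄, h₅, h₆⟩, hN⟩
  obtain ⟨σ, π, hs, hN⟩ := Nat.find_spec hex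
  have hmin : ∀ M σ π, IsSolution E V0 v0 w0 T0 w T c σ π → CompleteAt S π M →
      Nat.find hex ≤ M := fun M σ π h₁ h₂ => Nat.find_min' hex ⟨σ, π, h₁, h₂⟩
  generalize Nat.find hex = N at hN hmin
  obtain ⟨p, q, hpq, hNq, hq, hqp, hπ, hcase⟩ :=
    exists_repetition (t := t) (by simp) hN (fun M => hmin M σ π hs) fun m d hd hmd hcyc hS => by
      obtain ⟨σ', hs'⟩ := hs.skip hE hcyc (hS none) fun i => hS (some i)
      have := hmin _ _ _ hs' (hN.skip hmd hcyc hS)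
      omega
  obtain ⟨b, rfl⟩ := Nat.exists_eq_add_of_le hpq.le
  obtain ⟨σ', hs'⟩ := hs.wind hE (by omega) hNq (hN none) (fun i => hN (some i)) hπ
    (hcase.imp_right fun h i => h (some i))
  have hvis : ∀ o, (∃ k, π (wind p b k) ∈ S o) → ∃ k ≤ N, π (wind p b k) ∈ S o := by
    rintro o ⟨k, hk⟩
    obtain ⟨k, hkN, hk⟩ := hN o ⟨_, hk⟩
    exact ⟨k, hkN, by rwa [wind_of_lt (by omega)]⟩
  have hiff : ∀ o, (∃ k < max p N + 1, π (wind p b k) ∈ S o) ↔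
      ∃ k < max p N + 1 + b, π (wind p b k) ∈ S o := by
    refine fun o => ⟨fun ⟨k, hk, hkS⟩ => ⟨k, by omega, hkS⟩, fun ⟨k, _, hkS⟩ => ?_⟩
    obtain ⟨k, hk, hkS⟩ := hvis o ⟨k, hkS⟩
    exact ⟨k, by omega, hkS⟩
  refine ⟨σ', _, max p N + 1, b, hs'.isStrategy, hs'.isPlay, hs'.start, hs'.consistent,
    hs'.optimal, hs'.cost_le, ⟨by omega, fun k hk => ?_⟩, le_trans (by omega) hq, by omega,
    hiff none, fun i => hiff (some i), fun i => ?_⟩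
  · exact congrArg π (wind_add (by omega))
  · by_cases hv : ∃ k, π (wind p b k) ∈ T i
    · right
      refine (cost_le_of_visit hs'.isPlay (hW i) (hvis (some i) hv)).trans ?_
      rw [Nat.cast_le]
      refine Nat.mul_le_mul_right _ ((hNq.le.trans hq).trans ?_)
      exact Nat.mul_le_mul_right _ (by omega)
    · left
      push Not at hv
      exact cost_eq_top hv
end

section
/- The non-cooperative Pareto rational synthesis (NCPS) problem for quantitative reachability games with integer weights is undecidable: there is no algorithm that, given a finite quantitative reachability game in the Pareto setting whose weight functions take values in ℤ, an initial vertex v_0, and a threshold c ∈ ℕ, decides whether there exists a strategy σ_0 of player 0 such that every σ_0-fixed Pareto-optimal play π satisfies cost_0(π) ≤ c. Formally, under a natural effective encoding of such finite instances as natural numbers, the set of encodings of positive instances is not a decidable (computable) set. -/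
open scoped Classical

/-- The cost (in `ℤ ∪ {+∞}`) of a play for the integer weight function `w` and the
target set `T`: the accumulated weight up to the first visit of `T`, and `+∞` if `T`
is never visited. -/
noncomputable def costZ {V : Type*} (w : V → V → ℤ) (T : Set V) (π : ℕ → V) :
    WithTop ℤ :=
  if h : ∃ n, π n ∈ T then
    ((∑ j ∈ Finset.range (Nat.find h), w (π j) (π (j + 1)) : ℤ) : WithTop ℤ)
  else ⊤

/-- The payoff of a play: the tuple of the `t` environment costs, with the
componentwise partial order. -/
noncomputable def payZ {V : Type*} {t : ℕ} (w : Fin t → V → V → ℤ)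
    (T : Fin t → Set V) (π : ℕ → V) : Fin t → WithTop ℤ :=
  fun i => costZ (w i) (T i) π

/-- `π` is `σ0`-fixed Pareto-optimal: no play from `v0` consistent with `σ0` has a
strictly smaller payoff. -/
def ParetoOptimalZ {V : Type*} {t : ℕ} (E : V → V → Prop) (V0 : Set V) (v0 : V)
    (w : Fin t → V → V → ℤ) (T : Fin t → Set V) (σ0 : List V → V) (π : ℕ → V) :
    Prop :=
  ¬ ∃ π', IsPlay E π' ∧ π' 0 = v0 ∧ PlayConsistent V0 σ0 π' ∧
    payZ w T π' < payZ w T π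

/-- A finite instance of the non-cooperative Pareto rational synthesis problem with
integer weights: `n` vertices `0, …, n-1`, a list of edges, the list of vertices of
player 0, the weighted edges and target set of player 0, for each of the `t`
dimensions of the environment a list of weighted edges and a target set, an initial
vertex and a threshold. -/
structure NCPSInstance where
  n : ℕ
  t : ℕ
  edges : List (ℕ × ℕ)
  sys : List ℕ
  w0 : List (ℕ × ℕ × ℤ)
  w : List (List (ℕ × ℕ × ℤ))
  tgt0 : List ℕ
  tgt : List (List ℕ)
  v0 : ℕ
  c : ℕ

namespace NCPSInstance

/-- A natural effective encoding of instances. -/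
def encEquiv : NCPSInstance ≃
    ℕ × ℕ × List (ℕ × ℕ) × List ℕ × List (ℕ × ℕ × ℤ) × List (List (ℕ × ℕ × ℤ)) ×
      List ℕ × List (List ℕ) × ℕ × ℕ where
  toFun I := (I.n, I.t, I.edges, I.sys, I.w0, I.w, I.tgt0, I.tgt, I.v0, I.c)
  invFun p := ⟨p.1, p.2.1, p.2.2.1, p.2.2.2.1, p.2.2.2.2.1, p.2.2.2.2.2.1,
    p.2.2.2.2.2.2.1, p.2.2.2.2.2.2.2.1, p.2.2.2.2.2.2.2.2.1, p.2.2.2.2.2.2.2.2.2⟩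
  left_inv I := rfl
  right_inv p := rfl

instance : Primcodable NCPSInstance := Primcodable.ofEquiv _ encEquiv

/-- The edge relation of the instance, on the vertex set `Fin I.n`. -/
def Edge (I : NCPSInstance) (u v : Fin I.n) : Prop :=
  ((u : ℕ), (v : ℕ)) ∈ I.edges

/-- The set of vertices owned by player 0. -/
def sysSet (I : NCPSInstance) : Set (Fin I.n) := {v | (v : ℕ) ∈ I.sys}

/-- The weight of an edge obtained from a list of weighted edges. -/
def weightOf (l : List (ℕ × ℕ × ℤ)) (u v : ℕ) : ℤ :=
  ((l.filter fun p => p.1 == u && p.2.1 == v).map fun p => p.2.2).sum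

/-- The weight function of player 0. -/
def weight0 (I : NCPSInstance) (u v : Fin I.n) : ℤ :=
  weightOf I.w0 (u : ℕ) (v : ℕ)

/-- The weight function of dimension `i` of the environment. -/
def weight (I : NCPSInstance) (i : Fin I.t) (u v : Fin I.n) : ℤ :=
  weightOf (I.w.getD (i : ℕ) []) (u : ℕ) (v : ℕ)

/-- The target set of player 0. -/
def target0 (I : NCPSInstance) : Set (Fin I.n) := {v | (v : ℕ) ∈ I.tgt0}

/-- The target set of dimension `i` of the environment. -/
def target (I : NCPSInstance) (i : Fin I.t) : Set (Fin I.n) :=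
  {v | (v : ℕ) ∈ I.tgt.getD (i : ℕ) []}

/-- The instance is positive: it is well formed (the initial vertex exists and every
vertex has a successor) and there is a strategy `σ0` of player 0 such that every
`σ0`-fixed Pareto-optimal play `π` satisfies `cost₀ π ≤ c`. -/
def Positive (I : NCPSInstance) : Prop :=
  ∃ h0 : I.v0 < I.n,
    (∀ u : Fin I.n, ∃ v : Fin I.n, I.Edge u v) ∧
    ∃ σ0 : List (Fin I.n) → Fin I.n, IsStrategy I.Edge I.sysSet σ0 ∧
      ∀ π : ℕ → Fin I.n, IsPlay I.Edge π → π 0 = ⟨I.v0, h0⟩ →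
        PlayConsistent I.sysSet σ0 π →
        ParetoOptimalZ I.Edge I.sysSet ⟨I.v0, h0⟩ I.weight I.target σ0 π →
        costZ I.weight0 I.target0 π ≤ ((I.c : ℤ) : WithTop ℤ)

end NCPSInstance

/-! ### Counter programs -/

/-- Structured programs acting on counters indexed by `ℕ`; `loop r p` is
`while r ≠ 0 do (r := r - 1; p)`. -/
inductive CounterProg : Type
  | skip : CounterProg
  | inc : ℕ → CounterProg
  | seq : CounterProg → CounterProg → CounterProg
  | loop : ℕ → CounterProg → CounterProg

namespace CounterProg

open Function

/-- One computation step, on a stack of programs still to be executed and a counter valuation. -/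
inductive Step : List CounterProg × (ℕ → ℕ) → List CounterProg × (ℕ → ℕ) → Prop
  | skip (k s) : Step (skip :: k, s) (k, s)
  | inc (r k s) : Step (inc r :: k, s) (k, update s r (s r + 1))
  | seq (p q k s) : Step (seq p q :: k, s) (p :: q :: k, s)
  | loop_zero (r p k s) : s r = 0 → Step (loop r p :: k, s) (k, s)
  | loop_succ (r p k s m) : s r = m + 1 →
      Step (loop r p :: k, s) (p :: loop r p :: k, update s r m)

/-- Running the program transforms the first valuation into the second one. -/
def Exec (p : CounterProg) (s s' : ℕ → ℕ) : Prop :=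
  ∀ k, Relation.ReflTransGen Step (p :: k, s) (k, s')

theorem exec_skip (s : ℕ → ℕ) : Exec skip s s := fun k => .single (.skip k s)

theorem exec_inc (r : ℕ) (s : ℕ → ℕ) : Exec (inc r) s (update s r (s r + 1)) :=
  fun k => .single (.inc r k s)

theorem Exec.seq {p q : CounterProg} {s s' s'' : ℕ → ℕ} (hp : Exec p s s') (hq : Exec q s' s'') :
    Exec (seq p q) s s'' :=
  fun k => .head (.seq p q k s) ((hp (q :: k)).trans (hq k))

theorem exec_loop_zero {r : ℕ} (p : CounterProg) {s : ℕ → ℕ} (h : s r = 0) :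
    Exec (loop r p) s s :=
  fun k => .single (.loop_zero r p k s h)

theorem exec_loop_succ {r m : ℕ} {p : CounterProg} {s s' s'' : ℕ → ℕ} (h : s r = m + 1)
    (hp : Exec p (update s r m) s') (hl : Exec (loop r p) s' s'') : Exec (loop r p) s s'' :=
  fun k => .head (.loop_succ r p k s m h) ((hp _).trans (hl k))

/-- A loop whose counter is decremented only by the loop itself runs as a `for` loop. -/
theorem exec_loop_iterate {r : ℕ} {p : CounterProg} (S : ℕ → ℕ → ℕ) (N : ℕ)
    (hS : ∀ i ≤ N, S i r = N - i)
    (hp : ∀ i < N, Exec p (update (S i) r (N - i - 1)) (S (i + 1))) :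
    Exec (loop r p) (S 0) (S N) := by
  suffices h : ∀ j ≤ N, Exec (loop r p) (S (N - j)) (S N) by simpa using h N le_rfl
  intro j
  induction j with
  | zero =>
    intro _
    exact exec_loop_zero p (by simpa using hS N le_rfl)
  | succ j ih =>
    intro hj
    have h1 := hp (N - (j + 1)) (by omega)
    have h2 : N - (j + 1) + 1 = N - j := by omega
    have h3 : N - (N - (j + 1)) - 1 = j := by omega
    rw [h2, h3] at h1
    exact exec_loop_succ (by rw [hS _ (by omega)]; omega) h1 (ih (by omega))

theorem exec_clear (r : ℕ) (s : ℕ → ℕ) : Exec (loop r skip) s (update s r 0) := by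
  have h := exec_loop_iterate (r := r) (p := skip) (fun i => update s r (s r - i)) (s r)
    (by intro i _; simp) (by
      intro i _
      simp only [update_idem, Nat.sub_sub]
      exact exec_skip _)
  simpa using h

theorem exec_move {a o : ℕ} (hao : a ≠ o) (s : ℕ → ℕ) :
    Exec (loop a (inc o)) s (update (update s a 0) o (s o + s a)) := by
  have h := exec_loop_iterate (r := a) (p := inc o)
    (fun i => update (update s a (s a - i)) o (s o + i)) (s a)
    (by intro i _; simp [hao]) (by
      intro i _
      convert exec_inc o _ using 1
      funext r
      simp only [update_apply]
      split_ifs <;> omega)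
  simpa using h

/-- Copy the counter `a` into `o`, using the scratch counter `t`. -/
def copy (a o t : ℕ) : CounterProg := seq (loop a (seq (inc o) (inc t))) (loop t (inc a))

theorem exec_copy {a o t : ℕ} (hao : a ≠ o) (hat : a ≠ t) (hot : o ≠ t) (s : ℕ → ℕ)
    (ho : s o = 0) (ht : s t = 0) : Exec (copy a o t) s (update s o (s a)) := by
  have h := exec_loop_iterate (r := a) (p := seq (inc o) (inc t))
    (fun i => update (update (update s a (s a - i)) o i) t i) (s a)
    (by intro i _; simp [hao, hat]) (by
      intro i _
      convert (exec_inc o _).seq (exec_inc t _) using 1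
      funext r
      simp only [update_apply]
      split_ifs <;> omega)
  have h' := exec_move (Ne.symm hat) (update (update (update s a (s a - s a)) o (s a)) t (s a))
  have h0 : update (update (update s a (s a - 0)) o 0) t 0 = s := by
    funext r
    simp only [update_apply]
    split_ifs <;> simp_all
  simp only [h0] at h
  unfold copy
  convert h.seq h' using 1
  funext r
  simp only [update_apply]
  split_ifs <;> simp_all

/-- `f` is computed by counter programs, for every choice of input counters `a`, output counter `o`
and bound `b` above which all counters are available as scratch space. -/
def Computes {n : ℕ} (f : List.Vector ℕ n →. ℕ) : Prop :=
  ∀ (a : Fin n → ℕ) (o b : ℕ), (∀ i, a i < b) → o < b → (∀ i, a i ≠ o) →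
    ∃ p, ∀ s : ℕ → ℕ, (∀ r, b ≤ r → s r = 0) → s o = 0 →
      ∀ y ∈ f (List.Vector.ofFn fun i => s (a i)), Exec p s (update s o y)

theorem computes_zero : @Computes 0 (fun _ => 0 : List.Vector ℕ 0 → ℕ) := by
  intro a o b _ _ _
  refine ⟨skip, fun s _ ho y hy => ?_⟩
  obtain rfl : y = 0 := by simpa using hy
  rw [← ho, update_eq_self]
  exact exec_skip s

theorem computes_get {n : ℕ} (i : Fin n) :
    @Computes n (fun v => v.get i : List.Vector ℕ n → ℕ) := by
  intro a o b ha ho hao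
  refine ⟨copy (a i) o b, fun s hs hso y hy => ?_⟩
  obtain rfl : y = s (a i) := by simpa using hy
  exact exec_copy (hao i) (ha i).ne ho.ne s hso (hs b le_rfl)

theorem computes_succ :
    @Computes 1 (fun v => Nat.succ v.head : List.Vector ℕ 1 → ℕ) := by
  intro a o b ha ho hao
  refine ⟨seq (copy (a 0) o b) (inc o), fun s hs hso y hy => ?_⟩
  obtain rfl : y = s (a 0) + 1 := by simpa using hy
  have h := (exec_copy (hao 0) (ha 0).ne ho.ne s hso (hs b le_rfl)).seq (exec_inc o _)
  simpa using h

theorem exists_exec_clear_range (b m : ℕ) :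
    ∃ p, ∀ s : ℕ → ℕ, Exec p s fun r => if b ≤ r ∧ r < b + m then 0 else s r := by
  induction m with
  | zero =>
    refine ⟨skip, fun s => ?_⟩
    convert exec_skip s using 1
    funext r
    rw [if_neg (by omega)]
  | succ m ih =>
    obtain ⟨p, hp⟩ := ih
    refine ⟨seq p (loop (b + m) skip), fun s => ?_⟩
    convert (hp s).seq (exec_clear (b + m) _) using 1
    funext r
    simp only [update_apply]
    grind

theorem exists_exec_ofFn {m n : ℕ} {g : Fin n → List.Vector ℕ m →. ℕ} (hg : ∀ i, Computes (g i))
    (a : Fin m → ℕ) (b : ℕ) (ha : ∀ i, a i < b) (j : ℕ) (hj : j ≤ n) :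
    ∃ p, ∀ s : ℕ → ℕ, (∀ r, b ≤ r → s r = 0) → ∀ u : ℕ → ℕ,
      (∀ i : Fin n, u i ∈ g i (List.Vector.ofFn fun i => s (a i))) →
      Exec p s fun r => if b ≤ r ∧ r < b + j then u (r - b) else s r := by
  induction j with
  | zero =>
    refine ⟨skip, fun s _ u _ => ?_⟩
    convert exec_skip s using 1
    funext r
    rw [if_neg (by omega)]
  | succ j ih =>
    obtain ⟨p, hp⟩ := ih (by omega)
    obtain ⟨q, hq⟩ := hg ⟨j, hj⟩ a (b + j) (b + n) (fun i => by have := ha i; omega) (by omega)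
      (fun i => by have := ha i; omega)
    refine ⟨seq p q, fun s hs u hu => ?_⟩
    have h := hq (fun r => if b ≤ r ∧ r < b + j then u (r - b) else s r)
      (fun r hr => by rw [if_neg (by omega)]; exact hs r (by omega))
      (by rw [if_neg (by omega)]; exact hs _ (by omega)) (u j) (by
        have h1 : ∀ i, ¬ (b ≤ a i ∧ a i < b + j) := fun i => by have := ha i; omega
        simpa only [h1, if_false] using hu ⟨j, hj⟩)
    convert (hp s hs u hu).seq h using 1
    funext r
    simp only [update_apply]
    grind

theorem Computes.comp {m n : ℕ} {f : List.Vector ℕ n →. ℕ} {g : Fin n → List.Vector ℕ m →. ℕ}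
    {h : List.Vector ℕ m →. ℕ} (hf : Computes f) (hg : ∀ i, Computes (g i))
    (hh : ∀ v, ∀ y ∈ h v, ∃ u : List.Vector ℕ n, (∀ i, u.get i ∈ g i v) ∧ y ∈ f u) :
    Computes h := by
  intro a o b ha ho hao
  obtain ⟨p, hp⟩ := exists_exec_ofFn hg a b ha n le_rfl
  obtain ⟨q, hq⟩ := hf (fun i => b + i) o (b + n) (fun i => by omega) (by omega)
    (fun i => by omega)
  obtain ⟨c, hc⟩ := exists_exec_clear_range b n
  refine ⟨seq p (seq q c), fun s hs hso y hy => ?_⟩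
  obtain ⟨u, hu, hyu⟩ := hh _ y hy
  have h1 := hp s hs (fun j => if hj : j < n then u.get ⟨j, hj⟩ else 0) (fun i => by
    simpa using hu i)
  convert h1.seq (Exec.seq (hq _ (fun r hr => by rw [if_neg (by omega)]; exact hs r (by omega))
      (by rw [if_neg (by omega)]; exact hso) y ?_) (hc _)) using 1
  · funext r
    simp only [update_apply]
    grind
  · convert hyu
    ext i
    simp

theorem Computes.prec {n : ℕ} {f : List.Vector ℕ n → ℕ} {g : List.Vector ℕ (n + 2) → ℕ}
    (hf : @Computes n f) (hg : @Computes (n + 2) g) :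
    @Computes (n + 1) (fun v => v.head.rec (f v.tail) fun y IH => g (y ::ᵥ IH ::ᵥ v.tail) :
      List.Vector ℕ (n + 1) → ℕ) := by
  intro a o b ha ho hao
  obtain ⟨p, hp⟩ := hf (fun i => a i.succ) o b (fun i => ha _) ho (fun i => hao _)
  obtain ⟨q, hq⟩ := hg (Fin.cons (b + 1) (Fin.cons o fun i => a i.succ)) (b + 2) (b + 3)
    (by
      refine Fin.cases (by simp) (Fin.cases (by simp; omega) fun i => ?_)
      have := ha i.succ
      simp only [Fin.cons_succ]
      omega)
    (by omega)
    (by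
      refine Fin.cases (by simp) (Fin.cases (by simp; omega) fun i => ?_)
      have := ha i.succ
      simp only [Fin.cons_succ]
      omega)
  refine ⟨seq p (seq (copy (a 0) b (b + 2)) (seq
    (loop b (seq q (seq (loop o skip) (seq (loop (b + 2) (inc o)) (inc (b + 1))))))
    (loop (b + 1) skip))), fun s hs hso y hy => ?_⟩
  have ha0 := ha 0
  have hao0 := hao 0
  set t : List.Vector ℕ n := List.Vector.ofFn fun i => s (a i.succ) with ht
  set F : ℕ → ℕ := fun N => N.rec (f t) fun y IH => g (y ::ᵥ IH ::ᵥ t) with hF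
  have hy' : y = F (s (a 0)) := by
    simpa [List.Vector.ofFn, hF, ht] using hy
  have h1 := hp s hs hso (F 0) (by simp [hF, ht])
  have h2 := exec_copy (a := a 0) (o := b) (t := b + 2) (by omega) (by omega) (by omega)
    (update s o (F 0)) (by rw [update_of_ne (by omega)]; exact hs _ (by omega))
    (by rw [update_of_ne (by omega)]; exact hs _ (by omega))
  have h3 := exec_loop_iterate (r := b)
    (p := seq q (seq (loop o skip) (seq (loop (b + 2) (inc o)) (inc (b + 1)))))
    (fun i => update (update (update s o (F i)) b (s (a 0) - i)) (b + 1) i) (s (a 0))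
    (by intro i _; simp) (by
      intro i hi
      have h4 := hq (update (update (update s o (F i)) b (s (a 0) - i - 1)) (b + 1) i)
        (fun r hr => by
          rw [update_of_ne (by omega), update_of_ne (by omega), update_of_ne (by omega)]
          exact hs r (by omega))
        (by
          rw [update_of_ne (by omega), update_of_ne (by omega), update_of_ne (by omega)]
          exact hs _ (by omega)) (F (i + 1)) (by
          simp only [PFun.coe_val, Part.mem_some_iff]
          simp only [hF]
          congr 1
          simp only [List.Vector.ofFn, Fin.cons_zero, Fin.cons_succ, update_self]
          rw [update_of_ne (show o ≠ b + 1 by omega), update_of_ne (show o ≠ b by omega),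
            update_self]
          congr 3
          simp only [ht]
          congr 1
          funext j
          have := ha j.succ
          have := hao j.succ
          rw [update_of_ne (by omega), update_of_ne (by omega), update_of_ne (by omega)])
      have h5 : update (update (update (update s o (F i)) b (s (a 0) - i)) (b + 1) i) b
          (s (a 0) - i - 1) =
          update (update (update s o (F i)) b (s (a 0) - i - 1)) (b + 1) i := by
        funext r
        simp only [update_apply]
        grind
      rw [h5]
      convert h4.seq ((exec_clear o _).seq
        ((exec_move (a := b + 2) (o := o) (by omega) _).seq (exec_inc (b + 1) _))) using 1
      funext r
      have := hs (b + 2) (by omega)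
      simp only [update_apply]
      grind)
  have h6 : update (update s o (F 0)) b (update s o (F 0) (a 0)) =
      update (update (update s o (F 0)) b (s (a 0) - 0)) (b + 1) 0 := by
    funext r
    have := hs (b + 1) (by omega)
    simp only [update_apply]
    grind
  rw [h6] at h2
  convert h1.seq (h2.seq (h3.seq (exec_clear (b + 1) _))) using 1
  funext r
  have := hs (b + 1) (by omega)
  have := hs b (by omega)
  simp only [update_apply]
  grind

theorem Computes.rfind {n : ℕ} {f : List.Vector ℕ (n + 1) → ℕ} (hf : @Computes (n + 1) f) :
    Computes fun v : List.Vector ℕ n =>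
      Nat.rfind fun i => (some (decide (f (i ::ᵥ v) = 0)) : Part Bool) := by
  intro a o b ha ho hao
  obtain ⟨p, hp⟩ := hf (Fin.cons o a) b (b + 1)
    (Fin.cases (by simp; omega) fun i => by have := ha i; simp only [Fin.cons_succ]; omega)
    (by omega)
    (Fin.cases (by simp; omega) fun i => by have := ha i; simp only [Fin.cons_succ]; omega)
  refine ⟨seq p (loop b (seq (loop b skip) (seq (inc o) p))), fun s hs hso y hy => ?_⟩
  set t : List.Vector ℕ n := List.Vector.ofFn fun i => s (a i) with ht
  obtain ⟨hy0, hlt⟩ := Nat.mem_rfind.1 hy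
  have hy0 : f (y ::ᵥ t) = 0 := by simpa using hy0
  have hlt : ∀ m < y, f (m ::ᵥ t) ≠ 0 := fun m hm => by simpa using hlt hm
  have hb := hs b le_rfl
  have h1 : ∀ i, Exec p (update s o i) (update (update s o i) b (f (i ::ᵥ t))) := by
    intro i
    refine hp _ (fun r hr => by rw [update_of_ne (by omega)]; exact hs r (by omega))
      (by rw [update_of_ne (by omega)]; exact hb) _ ?_
    simp only [PFun.coe_val, Part.mem_some_iff]
    congr 1
    simp only [List.Vector.ofFn, Fin.cons_zero, Fin.cons_succ, update_self, ht]
    congr 2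
    funext j
    rw [update_of_ne (hao j)]
  have h2 : ∀ j ≤ y, Exec (loop b (seq (loop b skip) (seq (inc o) p)))
      (update (update s o (y - j)) b (f ((y - j) ::ᵥ t))) (update s o y) := by
    intro j
    induction j with
    | zero =>
      intro _
      have h3 : update (update s o (y - 0)) b (f ((y - 0) ::ᵥ t)) = update s o y := by
        funext r
        simp only [Nat.sub_zero, hy0, update_apply]
        grind
      rw [h3]
      exact exec_loop_zero _ (by rw [update_of_ne (by omega)]; exact hb)
    | succ j ih =>
      intro hj
      obtain ⟨m, hm⟩ := Nat.exists_eq_succ_of_ne_zero (hlt (y - (j + 1)) (by omega))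
      refine exec_loop_succ (m := m) (by simpa using hm) ?_ (ih (by omega))
      convert (exec_clear b _).seq ((exec_inc o _).seq ?_) using 1
      convert h1 (y - j) using 1
      funext r
      simp only [update_apply]
      grind
  convert (h1 0).seq (by simpa using h2 y le_rfl) using 1
  rw [← hso, update_eq_self]

theorem mem_of_mem_mOfFn {n : ℕ} {g : Fin n → Part ℕ} {u : List.Vector ℕ n}
    (hu : u ∈ List.Vector.mOfFn g) (i : Fin n) : u.get i ∈ g i := by
  induction n with
  | zero => exact i.elim0
  | succ n ih =>
    simp only [List.Vector.mOfFn, Part.bind_eq_bind, Part.mem_bind_iff, Part.pure_eq_some,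
      Part.mem_some_iff] at hu
    obtain ⟨x, hx, w, hw, rfl⟩ := hu
    refine Fin.cases ?_ (fun i => ?_) i
    · simpa using hx
    · simpa using ih hw i

theorem computes_of_primrec' {n : ℕ} {f : List.Vector ℕ n → ℕ} (hf : Nat.Primrec' f) :
    @Computes n f := by
  induction hf with
  | zero => exact computes_zero
  | succ => exact computes_succ
  | get i => exact computes_get i
  | comp g _ _ hf hg =>
    refine hf.comp hg fun v y hy => ⟨List.Vector.ofFn fun i => g i v, ?_, ?_⟩
    · simp
    · simpa using hy
  | prec _ _ hf hg => exact hf.prec hg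

theorem computes_of_partrec' {n : ℕ} {f : List.Vector ℕ n →. ℕ} (hf : Nat.Partrec' f) :
    Computes f := by
  induction hf with
  | prim h => exact computes_of_primrec' h
  | comp g _ _ hf hg =>
    refine hf.comp hg fun v y hy => ?_
    obtain ⟨u, hu, hy⟩ := Part.mem_bind_iff.1 hy
    exact ⟨u, mem_of_mem_mOfFn hu, hy⟩
  | rfind _ hf => exact Computes.rfind hf

end CounterProg

/-! ### Counter nets and their runs -/

/-- A control structure over integer counters: in each state a bit is chosen, which changes one
counter and determines the next state. The choice is legal if the changed counter is
nonnegative and, when `zero` is set, equal to zero. -/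
structure CounterNet (Q : Type) where
  next : Q → Bool → Q
  reg : Q → Bool → ℕ
  delta : Q → Bool → ℤ
  zero : Q → Bool → Bool

namespace CounterNet

variable {Q : Type} (N : CounterNet Q)

/-- The effect of choosing a bit. -/
def step (c : Q × (ℕ → ℤ)) (b : Bool) : Q × (ℕ → ℤ) :=
  (N.next c.1 b, fun r => c.2 r + if N.reg c.1 b = r then N.delta c.1 b else 0)

/-- Legality of the choice of a bit. -/
def Legal (c : Q × (ℕ → ℤ)) (b : Bool) : Prop :=
  0 ≤ (N.step c b).2 (N.reg c.1 b) ∧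
    (N.zero c.1 b = true → (N.step c b).2 (N.reg c.1 b) ≤ 0)

/-- The configurations visited when the bits `β` are chosen. -/
def run (β : ℕ → Bool) (c : Q × (ℕ → ℤ)) : ℕ → Q × (ℕ → ℤ)
  | 0 => c
  | j + 1 => N.step (run β c j) (β j)

/-- There is an infinite sequence of legal choices. -/
def HasLegalRun (c : Q × (ℕ → ℤ)) : Prop :=
  ∃ β : ℕ → Bool, ∀ j, N.Legal (N.run β c j) (β j)

theorem run_succ_eq (β : ℕ → Bool) (c : Q × (ℕ → ℤ)) (j : ℕ) :
    N.run β c (j + 1) = N.run (fun i => β (i + 1)) (N.step c (β 0)) j := by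
  induction j with
  | zero => rfl
  | succ j ih => rw [run, ih, run]

theorem hasLegalRun_iff (c : Q × (ℕ → ℤ)) :
    N.HasLegalRun c ↔ ∃ b, N.Legal c b ∧ N.HasLegalRun (N.step c b) := by
  constructor
  · rintro ⟨β, h⟩
    exact ⟨β 0, h 0, fun i => β (i + 1), fun j => by rw [← run_succ_eq]; exact h (j + 1)⟩
  · rintro ⟨b, hb, β, h⟩
    refine ⟨fun i => Nat.casesOn i b β, fun j => ?_⟩
    cases j with
    | zero => exact hb
    | succ j => rw [run_succ_eq]; exact h j

/-! ### The game of a counter net -/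

/-- The vertices of the game: player 0 chooses bits in the vertices `state q`, after which player 1
may halt the play in a `halt` vertex. -/
inductive Vertex (Q : Type) : Type
  | start : Vertex Q
  | ref : Vertex Q
  | state : Q → Vertex Q
  | choice : Q → Bool → Vertex Q
  | halt : Q → Bool → Vertex Q

open Vertex

/-- The edges of the game with initial state `q₀`. -/
inductive GameEdge (q₀ : Q) : Vertex Q → Vertex Q → Prop
  | start_ref : GameEdge q₀ start ref
  | start_state : GameEdge q₀ start (state q₀)
  | ref : GameEdge q₀ ref ref
  | choose (q b) : GameEdge q₀ (state q) (choice q b)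
  | next (q b) : GameEdge q₀ (choice q b) (state (N.next q b))
  | halt (q b) : GameEdge q₀ (choice q b) (halt q b)
  | stay (q b) : GameEdge q₀ (halt q b) (halt q b)

/-- The change of the counter `r` along an edge; the initial edge loads the initial value. -/
noncomputable def counterWeight (c : Q × (ℕ → ℤ)) (r : ℕ) : Vertex Q → Vertex Q → ℤ
  | start, state q => if q = c.1 then c.2 r else 0
  | state _, choice q b => if N.reg q b = r then N.delta q b else 0
  | _, _ => 0

/-- The weights: dimension `none` counts time, `some (r, true)` is the value of the counter `r` and
`some (r, false)` is its opposite. -/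
noncomputable def dimWeight (c : Q × (ℕ → ℤ)) : Option (ℕ × Bool) → Vertex Q → Vertex Q → ℤ
  | none, _, ref => 0
  | none, _, _ => 1
  | some (r, true), u, v => N.counterWeight c r u v
  | some (r, false), u, v => -N.counterWeight c r u v

/-- The vertices in the target of a dimension. -/
def InTarget : Option (ℕ × Bool) → Vertex Q → Prop
  | _, ref => True
  | none, halt _ _ => True
  | some (r, s), halt q b => N.reg q b = r ∧ (s = true ∨ N.zero q b = true)
  | _, _ => False

/-- The targets of the dimensions. -/
def dimTarget (d : Option (ℕ × Bool)) : Set (Vertex Q) := {v | N.InTarget d v}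

/-- The vertices of player 0. -/
def stateSet : Set (Vertex Q) := {v | ∃ q, v = state q}

/-- The play on which player 1 never stops. -/
def mainPlay (β : ℕ → Bool) (c : Q × (ℕ → ℤ)) : ℕ → Vertex Q
  | 0 => start
  | n + 1 => if n % 2 = 0 then state (N.run β c (n / 2)).1
      else choice (N.run β c (n / 2)).1 (β (n / 2))

/-- The play on which player 1 stops after the bit number `J`. -/
def stopPlay (β : ℕ → Bool) (c : Q × (ℕ → ℤ)) (J n : ℕ) : Vertex Q :=
  if n < 2 * J + 3 then N.mainPlay β c n else halt (N.run β c J).1 (β J)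

/-- The play on which player 1 immediately moves to `ref`. -/
def refPlay (n : ℕ) : Vertex Q := if n = 0 then start else ref

section Plays

variable (β : ℕ → Bool) (c : Q × (ℕ → ℤ))

theorem mainPlay_state (j : ℕ) : N.mainPlay β c (2 * j + 1) = state (N.run β c j).1 := by
  have h : 2 * j / 2 = j := by omega
  simp [mainPlay, h]

theorem mainPlay_choice (j : ℕ) :
    N.mainPlay β c (2 * j + 2) = choice (N.run β c j).1 (β j) := by
  have h : (2 * j + 1) / 2 = j := by omega
  have h' : (2 * j + 1) % 2 = 1 := by omega
  simp [mainPlay, h, h']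

theorem index_cases (n : ℕ) : n = 0 ∨ (∃ j, n = 2 * j + 1) ∨ ∃ j, n = 2 * j + 2 := by
  rcases Nat.even_or_odd' n with ⟨k, rfl | rfl⟩
  · rcases k with _ | k
    · simp
    · exact Or.inr (Or.inr ⟨k, by ring⟩)
  · exact Or.inr (Or.inl ⟨k, rfl⟩)

theorem isPlay_mainPlay : IsPlay (N.GameEdge c.1) (N.mainPlay β c) := by
  intro n
  obtain rfl | ⟨j, rfl⟩ | ⟨j, rfl⟩ := index_cases n
  · exact GameEdge.start_state
  · rw [mainPlay_state, mainPlay_choice]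
    exact .choose _ _
  · rw [mainPlay_choice, show 2 * j + 2 + 1 = 2 * (j + 1) + 1 by ring, mainPlay_state]
    exact .next _ _

theorem mainPlay_ne_ref (n : ℕ) : N.mainPlay β c n ≠ ref := by
  obtain rfl | ⟨j, rfl⟩ | ⟨j, rfl⟩ := index_cases n
  · simp [mainPlay]
  · simp [mainPlay_state]
  · simp [mainPlay_choice]

theorem mainPlay_notMem_dimTarget (n : ℕ) (d : Option (ℕ × Bool)) :
    N.mainPlay β c n ∉ N.dimTarget d := by
  obtain rfl | ⟨j, rfl⟩ | ⟨j, rfl⟩ := index_cases n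
  · cases d <;> simp [mainPlay, dimTarget, InTarget]
  · cases d <;> simp [mainPlay_state, dimTarget, InTarget]
  · cases d <;> simp [mainPlay_choice, dimTarget, InTarget]

theorem stopPlay_of_lt {J n : ℕ} (h : n < 2 * J + 3) :
    N.stopPlay β c J n = N.mainPlay β c n := if_pos h

theorem stopPlay_of_le {J n : ℕ} (h : 2 * J + 3 ≤ n) :
    N.stopPlay β c J n = halt (N.run β c J).1 (β J) := if_neg (by omega)

theorem isPlay_stopPlay (J : ℕ) : IsPlay (N.GameEdge c.1) (N.stopPlay β c J) := by
  intro n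
  rcases lt_trichotomy (n + 1) (2 * J + 3) with h | h | h
  · rw [stopPlay_of_lt _ _ _ (by omega), stopPlay_of_lt _ _ _ h]
    exact N.isPlay_mainPlay β c n
  · obtain rfl : n = 2 * J + 2 := by omega
    rw [stopPlay_of_lt _ _ _ (by omega), stopPlay_of_le _ _ _ (by omega), mainPlay_choice]
    exact .halt _ _
  · rw [stopPlay_of_le _ _ _ (by omega), stopPlay_of_le _ _ _ (by omega)]
    exact .stay _ _

theorem isPlay_refPlay (q₀ : Q) : IsPlay (N.GameEdge q₀) (refPlay : ℕ → Vertex Q) := by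
  intro n
  rcases n with _ | n
  · exact .start_ref
  · exact .ref

end Plays

theorem histList_succ {V : Type*} (π : ℕ → V) (n : ℕ) :
    histList π (n + 1) = histList π n ++ [π (n + 1)] := by
  simp [histList, List.range_succ]

theorem histList_congr {V : Type*} {π π' : ℕ → V} {n : ℕ} (h : ∀ m ≤ n, π m = π' m) :
    histList π n = histList π' n := by
  refine List.map_congr_left fun m hm => h m ?_
  rw [List.mem_range] at hm
  omega

theorem exists_histList_eq {V : Type*} (π : ℕ → V) (n : ℕ) :
    ∃ l, histList π n = l ++ [π n] := by
  exact ⟨(List.range n).map π, by simp [histList, List.range_succ]⟩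

theorem isChain_histList {V : Type*} {E : V → V → Prop} {π : ℕ → V} (h : IsPlay E π) (n : ℕ) :
    List.IsChain E (histList π n) := by
  rw [histList, List.isChain_map]
  rw [List.isChain_range]
  intro m _
  exact h m

/-- The strategy `σ` chooses the bits `β` along the main play. -/
def Follows (σ : List (Vertex Q) → Vertex Q) (β : ℕ → Bool) (c : Q × (ℕ → ℤ)) : Prop :=
  ∀ j, σ (histList (N.mainPlay β c) (2 * j + 1)) = choice (N.run β c j).1 (β j)

variable {N} in
theorem Follows.playConsistent_stopPlay {σ : List (Vertex Q) → Vertex Q} {β : ℕ → Bool}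
    {c : Q × (ℕ → ℤ)} (hσ : N.Follows σ β c) (J : ℕ) :
    PlayConsistent stateSet σ (N.stopPlay β c J) := by
  rintro n ⟨q, hq⟩
  by_cases h : n < 2 * J + 3
  · rw [stopPlay_of_lt _ _ _ h] at hq
    obtain rfl | ⟨j, rfl⟩ | ⟨j, rfl⟩ := index_cases n
    · simp [mainPlay] at hq
    · rw [stopPlay_of_lt _ _ _ (by omega), mainPlay_choice, ← hσ j]
      congr 1
      exact histList_congr fun m hm => (N.stopPlay_of_lt _ _ (by omega)).symm
    · simp [mainPlay_choice] at hq
  · rw [stopPlay_of_le _ _ _ (by omega)] at hq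
    simp at hq

theorem playConsistent_refPlay (σ : List (Vertex Q) → Vertex Q) :
    PlayConsistent stateSet σ refPlay := by
  rintro n ⟨q, hq⟩
  unfold refPlay at hq
  split_ifs at hq

variable {N} in
/-- The plays consistent with a strategy. -/
theorem Follows.play_cases {σ : List (Vertex Q) → Vertex Q} {β : ℕ → Bool}
    {c : Q × (ℕ → ℤ)} (hσ : N.Follows σ β c) {π : ℕ → Vertex Q} (hπ : IsPlay (N.GameEdge c.1) π)
    (h0 : π 0 = start) (hc : PlayConsistent stateSet σ π) :
    π 1 = ref ∨ π = N.mainPlay β c ∨ ∃ J, π = N.stopPlay β c J := by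
  by_cases hm : ∃ n, π n ≠ N.mainPlay β c n
  swap
  · push Not at hm
    exact Or.inr (Or.inl (funext hm))
  have hne := Nat.find_spec hm
  have heq : ∀ m < Nat.find hm, π m = N.mainPlay β c m := fun m hlt => by
    simpa using Nat.find_min hm hlt
  generalize Nat.find hm = n at hne heq
  rcases n with _ | n
  · exact absurd h0 hne
  have hn := heq n (by omega)
  have hE := hπ n
  obtain rfl | ⟨j, rfl⟩ | ⟨j, rfl⟩ := index_cases n
  · rw [h0] at hE
    generalize π (0 + 1) = v at hE hne ⊢
    cases hE with
    | start_ref => exact Or.inl rfl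
    | start_state => exact absurd rfl hne
  · rw [mainPlay_state] at hn
    have h := hc _ ⟨_, hn⟩
    rw [histList_congr (π' := N.mainPlay β c) fun m hm => heq m (by omega), hσ j] at h
    exact absurd (h.trans (N.mainPlay_choice β c j).symm) hne
  · rw [mainPlay_choice] at hn
    rw [hn] at hE
    have hhalt : π (2 * j + 3) = halt (N.run β c j).1 (β j) := by
      cases h1 : π (2 * j + 3) with
      | halt q b =>
        rw [h1] at hE
        cases hE
        rfl
      | state q =>
        rw [h1] at hE
        refine absurd ?_ hne
        rw [show 2 * j + 2 + 1 = 2 * (j + 1) + 1 by ring, mainPlay_state]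
        change π (2 * j + 3) = _
        rw [h1]
        cases hE
        rfl
      | _ => rw [h1] at hE; cases hE
    refine Or.inr (Or.inr ⟨j, funext fun m => ?_⟩)
    by_cases hm : m < 2 * j + 3
    · rw [stopPlay_of_lt _ _ _ hm]
      exact heq m hm
    · obtain ⟨i, rfl⟩ := Nat.exists_eq_add_of_le (not_lt.1 hm)
      rw [stopPlay_of_le _ _ _ (by omega)]
      clear hm
      induction i with
      | zero => exact hhalt
      | succ i ih =>
        have h := hπ (2 * j + 3 + i)
        rw [ih] at h
        rw [← Nat.add_assoc]
        generalize π (2 * j + 3 + i + 1) = v at h ⊢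
        cases h
        rfl

/-- Every sequence of bits is chosen by some strategy. -/
theorem exists_strategy_follows (β : ℕ → Bool) (c : Q × (ℕ → ℤ)) :
    ∃ σ, IsStrategy (N.GameEdge c.1) stateSet σ ∧ N.Follows σ β c := by
  refine ⟨fun l => if N.GameEdge c.1 (l.getLastD start) (N.mainPlay β c l.length) then
    N.mainPlay β c l.length else match l.getLastD start with
      | state q => choice q true
      | v => v, ?_, ?_⟩
  · rintro l _ - ⟨q, rfl⟩
    simp only [List.getLastD_concat]
    split_ifs with h
    · exact h
    · exact .choose _ _
  · intro j
    obtain ⟨l, hl⟩ := exists_histList_eq (N.mainPlay β c) (2 * j + 1)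
    have hlen : (l ++ [N.mainPlay β c (2 * j + 1)]).length = 2 * j + 2 := by
      rw [← hl]
      simp [histList]
    simp only [hl, hlen, List.getLastD_concat]
    rw [if_pos (N.isPlay_mainPlay β c (2 * j + 1)), mainPlay_choice]

/-- Every strategy chooses some sequence of bits. -/
theorem exists_follows {c : Q × (ℕ → ℤ)} {σ : List (Vertex Q) → Vertex Q}
    (hσ : IsStrategy (N.GameEdge c.1) stateSet σ) : ∃ β, N.Follows σ β c := by
  let nx : List (Vertex Q) → Vertex Q := fun l => match l.getLastD start with
    | start => state c.1
    | state _ => σ l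
    | choice q b => state (N.next q b)
    | v => v
  let H : ℕ → List (Vertex Q) := fun n => Nat.rec [start] (fun _ l => l ++ [nx l]) n
  let β : ℕ → Bool := fun j => match nx (H (2 * j + 1)) with
    | choice _ b => b
    | _ => false
  have key : ∀ j, histList (N.mainPlay β c) (2 * j + 1) = H (2 * j + 1) →
      nx (H (2 * j + 1)) = choice (N.run β c j).1 (β j) ∧
        σ (H (2 * j + 1)) = choice (N.run β c j).1 (β j) := by
    intro j hj
    obtain ⟨l, hl⟩ := exists_histList_eq (N.mainPlay β c) (2 * j + 1)
    have hchain := isChain_histList (N.isPlay_mainPlay β c) (2 * j + 1)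
    rw [mainPlay_state] at hl
    rw [hl] at hchain hj
    have hE := hσ l _ hchain ⟨_, rfl⟩
    have hnx : nx (H (2 * j + 1)) = σ (H (2 * j + 1)) := by
      rw [← hj]
      simp [nx]
    have hβ : β j = match nx (H (2 * j + 1)) with
      | choice _ b => b
      | _ => false := rfl
    rw [hnx] at hβ ⊢
    rw [hj] at hE
    generalize σ (H (2 * j + 1)) = v at hE hβ
    cases hE
    simp [hβ]
  have hist : ∀ n, histList (N.mainPlay β c) n = H n := by
    intro n
    induction n with
    | zero => rfl
    | succ n ih =>
      rw [histList_succ]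
      change _ = H n ++ [nx (H n)]
      rw [ih]
      congr 2
      obtain rfl | ⟨j, rfl⟩ | ⟨j, rfl⟩ := index_cases n
      · rfl
      · rw [(key j ih).1, mainPlay_choice]
      · obtain ⟨l, hl⟩ := exists_histList_eq (N.mainPlay β c) (2 * j + 2)
        rw [← ih, hl, mainPlay_choice, show 2 * j + 2 + 1 = 2 * (j + 1) + 1 by ring,
          mainPlay_state]
        simp [nx, run, step]
  exact ⟨β, fun j => by rw [hist]; exact (key j (hist _)).2⟩

/-! ### Costs of the plays -/

theorem costZ_eq_sum {V : Type*} (w : V → V → ℤ) {T : Set V} {π : ℕ → V} {n : ℕ} (hn : π n ∈ T)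
    (hlt : ∀ m < n, π m ∉ T) :
    costZ w T π = ((∑ j ∈ Finset.range n, w (π j) (π (j + 1)) : ℤ) : WithTop ℤ) := by
  have h : ∃ n, π n ∈ T := ⟨n, hn⟩
  rw [costZ, dif_pos h, (Nat.find_eq_iff h).2 ⟨hn, hlt⟩]

theorem costZ_eq_top {V : Type*} (w : V → V → ℤ) {T : Set V} {π : ℕ → V} (h : ∀ n, π n ∉ T) :
    costZ w T π = ⊤ := dif_neg (by push Not; exact h)

theorem costZ_zero {V : Type*} {T : Set V} {π : ℕ → V} (h : ∃ n, π n ∈ T) :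
    costZ (fun _ _ => 0) T π = 0 := by
  rw [costZ, dif_pos h]
  simp

section Costs

variable (β : ℕ → Bool) (c : Q × (ℕ → ℤ))

theorem cost_refPlay (d : Option (ℕ × Bool)) :
    costZ (N.dimWeight c d) (N.dimTarget d) refPlay = 0 := by
  rw [costZ_eq_sum (n := 1)]
  · rcases d with _ | ⟨r, _ | _⟩ <;> simp [refPlay, dimWeight, counterWeight]
  · cases d <;> simp [refPlay, dimTarget, InTarget]
  · intro m hm
    obtain rfl : m = 0 := by omega
    cases d <;> simp [refPlay, dimTarget, InTarget]

theorem cost_mainPlay (d : Option (ℕ × Bool)) :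
    costZ (N.dimWeight c d) (N.dimTarget d) (N.mainPlay β c) = ⊤ :=
  costZ_eq_top _ fun n => N.mainPlay_notMem_dimTarget β c n d

theorem cost_stopPlay_of_notMem {d : Option (ℕ × Bool)} {J : ℕ}
    (h : halt (N.run β c J).1 (β J) ∉ N.dimTarget d) :
    costZ (N.dimWeight c d) (N.dimTarget d) (N.stopPlay β c J) = ⊤ := by
  refine costZ_eq_top _ fun n => ?_
  unfold stopPlay
  split_ifs
  · exact N.mainPlay_notMem_dimTarget β c n d
  · exact h

theorem cost_stopPlay_of_mem {d : Option (ℕ × Bool)} {J : ℕ}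
    (h : halt (N.run β c J).1 (β J) ∈ N.dimTarget d) :
    costZ (N.dimWeight c d) (N.dimTarget d) (N.stopPlay β c J) =
      ((∑ n ∈ Finset.range (2 * J + 3), N.dimWeight c d (N.stopPlay β c J n)
        (N.stopPlay β c J (n + 1)) : ℤ) : WithTop ℤ) := by
  refine costZ_eq_sum _ ?_ fun m hm => ?_
  · rwa [stopPlay_of_le _ _ _ le_rfl]
  · rw [stopPlay_of_lt _ _ _ hm]
    exact N.mainPlay_notMem_dimTarget β c m d

theorem sum_counterWeight_mainPlay (r J : ℕ) :
    ∑ n ∈ Finset.range (2 * J + 1), N.counterWeight c r (N.mainPlay β c n)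
      (N.mainPlay β c (n + 1)) = (N.run β c J).2 r := by
  induction J with
  | zero => simp [mainPlay, counterWeight, run]
  | succ J ih =>
    rw [show 2 * (J + 1) + 1 = 2 * J + 1 + 1 + 1 by ring, Finset.sum_range_succ,
      Finset.sum_range_succ, ih, show 2 * J + 1 + 1 + 1 = 2 * (J + 1) + 1 by ring]
    simp only [mainPlay_state, mainPlay_choice]
    simp [counterWeight, run, step]

theorem sum_counterWeight_stopPlay (r J : ℕ) :
    ∑ n ∈ Finset.range (2 * J + 3), N.counterWeight c r (N.stopPlay β c J n)
      (N.stopPlay β c J (n + 1)) = (N.run β c (J + 1)).2 r := by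
  rw [← N.sum_counterWeight_mainPlay β c, show 2 * (J + 1) + 1 = 2 * J + 2 + 1 by ring,
    show 2 * J + 3 = 2 * J + 2 + 1 by ring, Finset.sum_range_succ _ (2 * J + 2),
    Finset.sum_range_succ _ (2 * J + 2)]
  congr 1
  · refine Finset.sum_congr rfl fun n hn => ?_
    rw [Finset.mem_range] at hn
    rw [stopPlay_of_lt _ _ _ (by omega), stopPlay_of_lt _ _ _ (by omega)]
  · rw [stopPlay_of_lt _ _ _ (by omega), stopPlay_of_le _ _ _ (by omega), mainPlay_choice,
      show 2 * J + 2 + 1 = 2 * (J + 1) + 1 by ring, mainPlay_state]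
    simp [counterWeight]

theorem cost_stopPlay_none (J : ℕ) :
    costZ (N.dimWeight c none) (N.dimTarget none) (N.stopPlay β c J) =
      ((2 * J + 3 : ℤ) : WithTop ℤ) := by
  rw [cost_stopPlay_of_mem _ _ _ (by simp [dimTarget, InTarget])]
  have hw : ∀ n, N.dimWeight c none (N.stopPlay β c J n) (N.stopPlay β c J (n + 1)) = 1 := by
    intro n
    have h : N.stopPlay β c J (n + 1) ≠ ref := by
      unfold stopPlay
      split_ifs
      · exact N.mainPlay_ne_ref β c _
      · simp
    cases hv : N.stopPlay β c J (n + 1) <;> simp_all [dimWeight]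
  simp [hw]

theorem cost_stopPlay_pos (J : ℕ) :
    costZ (N.dimWeight c (some (N.reg (N.run β c J).1 (β J), true)))
      (N.dimTarget (some (N.reg (N.run β c J).1 (β J), true))) (N.stopPlay β c J) =
      ((N.run β c (J + 1)).2 (N.reg (N.run β c J).1 (β J)) : WithTop ℤ) := by
  rw [cost_stopPlay_of_mem _ _ _ (by simp [dimTarget, InTarget]), ← sum_counterWeight_stopPlay]
  rfl

theorem cost_stopPlay_neg (J : ℕ) (hz : N.zero (N.run β c J).1 (β J) = true) :
    costZ (N.dimWeight c (some (N.reg (N.run β c J).1 (β J), false)))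
      (N.dimTarget (some (N.reg (N.run β c J).1 (β J), false))) (N.stopPlay β c J) =
      ((-(N.run β c (J + 1)).2 (N.reg (N.run β c J).1 (β J)) : ℤ) : WithTop ℤ) := by
  rw [cost_stopPlay_of_mem _ _ _ (by simp [dimTarget, InTarget, hz]), ← sum_counterWeight_stopPlay,
    ← Finset.sum_neg_distrib]
  rfl

variable {N β c} in
theorem Legal.cost_stopPlay_nonneg {J : ℕ} (h : N.Legal (N.run β c J) (β J))
    (d : Option (ℕ × Bool)) :
    0 ≤ costZ (N.dimWeight c d) (N.dimTarget d) (N.stopPlay β c J) := by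
  by_cases hm : halt (N.run β c J).1 (β J) ∈ N.dimTarget d
  · rcases d with _ | ⟨r, _ | _⟩
    · rw [cost_stopPlay_none]
      exact_mod_cast (by positivity : (0 : ℤ) ≤ 2 * J + 3)
    · obtain ⟨rfl, hz⟩ : N.reg (N.run β c J).1 (β J) = r ∧ N.zero (N.run β c J).1 (β J) = true := by
        simpa [dimTarget, InTarget] using hm
      rw [cost_stopPlay_neg _ _ _ _ hz]
      exact_mod_cast neg_nonneg.2 (h.2 hz)
    · obtain rfl : N.reg (N.run β c J).1 (β J) = r := by
        simpa [dimTarget, InTarget] using hm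
      rw [cost_stopPlay_pos]
      exact_mod_cast h.1
  · rw [cost_stopPlay_of_notMem _ _ _ hm]
    exact le_top

end Costs

variable {V : Type*} {t : ℕ}

/-- Player 0 has a strategy for which all fixed Pareto-optimal plays have cost at most `k`. -/
def GamePositive (E : V → V → Prop) (V0 : Set V) (v0 : V) (w0 : V → V → ℤ) (T0 : Set V)
    (w : Fin t → V → V → ℤ) (T : Fin t → Set V) (k : ℕ) : Prop :=
  ∃ σ0 : List V → V, IsStrategy E V0 σ0 ∧
    ∀ π : ℕ → V, IsPlay E π → π 0 = v0 → PlayConsistent V0 σ0 π →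
      ParetoOptimalZ E V0 v0 w T σ0 π → costZ w0 T0 π ≤ ((k : ℤ) : WithTop ℤ)

theorem gamePositive_iff_hasLegalRun (c : Q × (ℕ → ℤ)) (dim : Fin t → Option (ℕ × Bool))
    (hnone : ∃ i, dim i = none) (hsome : ∀ q b s, ∃ i, dim i = some (N.reg q b, s)) :
    GamePositive (N.GameEdge c.1) stateSet start (fun _ _ => 0) {ref}
      (fun i => N.dimWeight c (dim i)) (fun i => N.dimTarget (dim i)) 0 ↔ N.HasLegalRun c := by
  obtain ⟨i₀, hi₀⟩ := hnone
  constructor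
  · rintro ⟨σ, hσ, hπ⟩
    obtain ⟨β, hβ⟩ := N.exists_follows hσ
    by_contra hrun
    have hex : ∃ j, ¬ N.Legal (N.run β c j) (β j) := by
      by_contra! h
      exact hrun ⟨β, h⟩
    obtain ⟨J, hJ, hmin⟩ : ∃ J, ¬ N.Legal (N.run β c J) (β J) ∧
        ∀ j < J, N.Legal (N.run β c j) (β j) :=
      ⟨Nat.find hex, Nat.find_spec hex, fun j hj => by simpa using Nat.find_min hex hj⟩
    have hneg : ∃ i, costZ (N.dimWeight c (dim i)) (N.dimTarget (dim i))
        (N.stopPlay β c J) < 0 := by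
      by_contra! h
      refine hJ ⟨?_, fun hz => ?_⟩
      · obtain ⟨i, hi⟩ := hsome (N.run β c J).1 (β J) true
        have := h i
        rw [hi, cost_stopPlay_pos] at this
        exact_mod_cast this
      · obtain ⟨i, hi⟩ := hsome (N.run β c J).1 (β J) false
        have := h i
        rw [hi, cost_stopPlay_neg _ _ _ _ hz] at this
        exact neg_nonneg.1 (by exact_mod_cast this)
    obtain ⟨i, hi⟩ := hneg
    have hcost := hπ _ (N.isPlay_stopPlay β c J) (by simp [stopPlay, mainPlay])
      (hβ.playConsistent_stopPlay J) (by
        rintro ⟨π', hp, h0, hc, hlt⟩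
        have hle := hlt.le
        obtain h1 | rfl | ⟨J', rfl⟩ := hβ.play_cases hp h0 hc
        · have h2 : π' = refPlay := by
            funext n
            rcases n with _ | n
            · exact h0
            · induction n with
              | zero => exact h1
              | succ n ih =>
                have h3 := hp (n + 1)
                rw [ih] at h3
                generalize π' (n + 1 + 1) = v at h3 ⊢
                cases h3
                rfl
          subst h2
          have := hle i
          simp only [payZ, cost_refPlay] at this
          exact absurd hi (not_lt.2 this)
        · have := hle i₀
          simp only [payZ, hi₀, cost_mainPlay, cost_stopPlay_none] at this
          exact absurd (top_le_iff.1 this) WithTop.coe_ne_top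
        · have := hle i₀
          simp only [payZ, hi₀, cost_stopPlay_none] at this
          have hJJ : J' ≤ J := by
            have : (2 * J' + 3 : ℤ) ≤ 2 * J + 3 := by exact_mod_cast this
            omega
          rcases hJJ.eq_or_lt with rfl | hJJ
          · exact lt_irrefl _ hlt
          · exact absurd hi (not_lt.2 (((hmin J' hJJ).cost_stopPlay_nonneg (dim i)).trans (hle i))))
    rw [costZ_eq_top] at hcost
    · simp at hcost
    · intro n
      unfold stopPlay
      split_ifs
      · exact N.mainPlay_ne_ref β c n
      · simp
  · rintro ⟨β, hβ⟩
    obtain ⟨σ, hσ, hf⟩ := N.exists_strategy_follows β c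
    refine ⟨σ, hσ, fun π hp h0 hc hopt => ?_⟩
    by_cases h1 : π 1 = ref
    · rw [costZ_zero ⟨1, h1⟩]
      simp
    · refine absurd ⟨refPlay, N.isPlay_refPlay c.1, rfl, playConsistent_refPlay σ, ?_⟩ hopt
      have hd : (∀ d, 0 ≤ costZ (N.dimWeight c d) (N.dimTarget d) π) ∧
          0 < costZ (N.dimWeight c none) (N.dimTarget none) π := by
        obtain h | rfl | ⟨J, rfl⟩ := hf.play_cases hp h0 hc
        · exact absurd h h1
        · simp [cost_mainPlay]
        · refine ⟨(hβ J).cost_stopPlay_nonneg, ?_⟩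
          rw [cost_stopPlay_none]
          exact_mod_cast (by positivity : (0 : ℤ) < 2 * J + 3)
      refine Pi.lt_def.2 ⟨fun i => ?_, i₀, ?_⟩
      · simpa [payZ, cost_refPlay] using hd.1 (dim i)
      · simpa [payZ, cost_refPlay, hi₀] using hd.2

end CounterNet

/-! ### Counter programs as counter nets -/

namespace CounterNet

variable {Q : Type} (N : CounterNet Q)

/-- The restriction of a counter net to a set of states closed under `next`. -/
def restrict (S : Set Q) (hS : ∀ q ∈ S, ∀ b, N.next q b ∈ S) : CounterNet S where
  next q b := ⟨N.next q b, hS q q.2 b⟩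
  reg q b := N.reg q b
  delta q b := N.delta q b
  zero q b := N.zero q b

theorem step_eq_update (c : Q × (ℕ → ℤ)) (b : Bool) :
    N.step c b =
      (N.next c.1 b, Function.update c.2 (N.reg c.1 b) (c.2 (N.reg c.1 b) + N.delta c.1 b)) := by
  refine Prod.ext rfl (funext fun r => ?_)
  by_cases h : r = N.reg c.1 b
  · subst h
    simp [step]
  · simp [step, Function.update_of_ne h, Ne.symm h]

theorem legal_iff (c : Q × (ℕ → ℤ)) (b : Bool) :
    N.Legal c b ↔ 0 ≤ c.2 (N.reg c.1 b) + N.delta c.1 b ∧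
      (N.zero c.1 b = true → c.2 (N.reg c.1 b) + N.delta c.1 b ≤ 0) := by
  simp [Legal, step]

theorem hasLegalRun_restrict {S : Set Q} (hS : ∀ q ∈ S, ∀ b, N.next q b ∈ S) (q : S)
    (x : ℕ → ℤ) : (N.restrict S hS).HasLegalRun (q, x) ↔ N.HasLegalRun (q, x) := by
  have hrun : ∀ β j, N.run β (q, x) j = (((N.restrict S hS).run β (q, x) j).1.1,
      ((N.restrict S hS).run β (q, x) j).2) := by
    intro β j
    induction j with
    | zero => rfl
    | succ j ih => rw [run, ih]; rfl
  refine exists_congr fun β => forall_congr' fun j => ?_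
  rw [hrun]
  rfl

end CounterNet

namespace CounterProg

/-- The counter net executing stacks of counter programs. When the stack is empty it tests forever
that the counter `1` is zero. -/
def net : CounterNet (List CounterProg) where
  next
    | skip :: k, _ => k
    | inc _ :: k, _ => k
    | seq p q :: k, _ => p :: q :: k
    | loop r p :: k, true => p :: loop r p :: k
    | loop _ _ :: k, false => k
    | [], _ => []
  reg
    | inc r :: _, _ => r
    | loop r _ :: _, _ => r
    | [], _ => 1
    | _, _ => 0
  delta
    | inc _ :: _, _ => 1
    | loop _ _ :: _, true => -1
    | _, _ => 0
  zero
    | loop _ _ :: _, false => true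
    | [], _ => true
    | _, _ => false

open CounterNet

theorem natCast_update (s : ℕ → ℕ) (r m : ℕ) :
    (fun r' => ((Function.update s r m r' : ℕ) : ℤ)) =
      Function.update (fun r' => (s r' : ℤ)) r m := by
  funext r'
  exact Function.apply_update (fun _ (k : ℕ) => (k : ℤ)) s r m r'

theorem Step.hasLegalRun_iff {c c' : List CounterProg × (ℕ → ℕ)} (h : Step c c') :
    net.HasLegalRun (c.1, fun r => (c.2 r : ℤ)) ↔
      net.HasLegalRun (c'.1, fun r => (c'.2 r : ℤ)) := by
  rw [net.hasLegalRun_iff, Bool.exists_bool]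
  simp only [legal_iff, step_eq_update]
  generalize net.HasLegalRun = P
  cases h with
  | skip k s => simp [net]
  | inc r k s =>
    have hs : (0 : ℤ) ≤ s r + 1 := by positivity
    simp only [natCast_update]
    simp [net, hs]
  | seq p q k s => simp [net]
  | loop_zero r p k s h =>
    have h' : (s r : ℤ) = 0 := by exact_mod_cast h
    have hr : Function.update (fun r' => (s r' : ℤ)) r 0 = fun r' => (s r' : ℤ) := by
      rw [← h', Function.update_eq_self]
    simp [net, h, hr]
  | loop_succ r p k s m h =>
    have hm : ¬ (m : ℤ) + 1 ≤ 0 := by omega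
    simp only [natCast_update]
    simp [net, h, hm]

theorem hasLegalRun_nil (x : ℕ → ℤ) : net.HasLegalRun ([], x) ↔ x 1 = 0 := by
  have hstep : ∀ b, net.step ([], x) b = ([], x) := fun b => by
    rw [step_eq_update]
    simp [net]
  have hlegal : ∀ b, net.Legal ([], x) b ↔ x 1 = 0 := fun b => by
    rw [Legal, hstep]
    simp only [net]
    constructor
    · rintro ⟨h, h'⟩
      exact le_antisymm (h' trivial) h
    · intro h
      simp [h]
  constructor
  · rintro ⟨β, h⟩
    exact (hlegal _).1 (h 0)
  · intro h
    refine ⟨fun _ => true, fun j => ?_⟩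
    have hrun : net.run (fun _ => true) ([], x) j = ([], x) := by
      induction j with
      | zero => rfl
      | succ j ih => rw [run, ih, hstep]
    rw [hrun]
    exact (hlegal _).2 h

theorem Exec.hasLegalRun_iff {p : CounterProg} {s s' : ℕ → ℕ} (h : Exec p s s') :
    net.HasLegalRun ([p], fun r => (s r : ℤ)) ↔ s' 1 = 0 := by
  have key : ∀ c c', Relation.ReflTransGen Step c c' →
      (net.HasLegalRun (c.1, fun r => (c.2 r : ℤ)) ↔
        net.HasLegalRun (c'.1, fun r => (c'.2 r : ℤ))) := by
    intro c c' hr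
    induction hr with
    | refl => rfl
    | tail _ hs ih => exact ih.trans hs.hasLegalRun_iff
  rw [key _ _ (h []), hasLegalRun_nil]
  simp

/-- The stacks arising in the execution of `p` on top of the stack `k`, before `k` is reached. -/
def support : CounterProg → List CounterProg → Set (List CounterProg)
  | skip, k => {skip :: k}
  | inc r, k => {inc r :: k}
  | seq p q, k => {seq p q :: k} ∪ support p (q :: k) ∪ support q k
  | loop r p, k => {loop r p :: k} ∪ support p (loop r p :: k)

theorem finite_support (p : CounterProg) (k : List CounterProg) : (support p k).Finite := by
  induction p generalizing k with
  | skip => simp [support]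
  | inc r => simp [support]
  | seq p q hp hq => exact ((Set.finite_singleton _).union (hp _)).union (hq _)
  | loop r p hp => exact (Set.finite_singleton _).union (hp _)

theorem cons_mem_support (p : CounterProg) (k : List CounterProg) : p :: k ∈ support p k := by
  cases p <;> simp [support]

theorem next_mem_support {p : CounterProg} {k l : List CounterProg} (hl : l ∈ support p k)
    (b : Bool) : net.next l b ∈ support p k ∨ net.next l b = k := by
  induction p generalizing k with
  | skip => obtain rfl := hl; exact Or.inr rfl
  | inc r => obtain rfl := hl; exact Or.inr rfl
  | seq p q hp hq =>
    obtain (rfl | hl) | hl := hl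
    · exact Or.inl (Or.inl (Or.inr (cons_mem_support p _)))
    · obtain h | h := hp hl
      · exact Or.inl (Or.inl (Or.inr h))
      · rw [h]
        exact Or.inl (Or.inr (cons_mem_support q k))
    · obtain h | h := hq hl
      · exact Or.inl (Or.inr h)
      · exact Or.inr h
  | loop r p hp =>
    obtain rfl | hl := hl
    · cases b
      · exact Or.inr rfl
      · exact Or.inl (Or.inr (cons_mem_support p _))
    · obtain h | h := hp hl
      · exact Or.inl (Or.inr h)
      · rw [h]
        exact Or.inl (Or.inl rfl)

/-- The finite set of stacks arising in the execution of `p`. -/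
def stackSet (p : CounterProg) : Set (List CounterProg) := insert [] (support p [])

theorem next_mem_stackSet (p : CounterProg) : ∀ l ∈ stackSet p, ∀ b, net.next l b ∈ stackSet p := by
  rintro l (rfl | hl) b
  · exact Or.inl rfl
  · exact (next_mem_support hl b).symm

end CounterProg

/-! ### Encoding finite games as instances -/

namespace CounterNet

theorem GamePositive.comap {U V : Type*} {t : ℕ} {E : V → V → Prop}
    {V0 : Set V} {v0 : V} {w0 : V → V → ℤ} {T0 : Set V} {w : Fin t → V → V → ℤ}
    {T : Fin t → Set V} {k : ℕ} (h : GamePositive E V0 v0 w0 T0 w T k) (e : U ≃ V) :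
    GamePositive (fun u v => E (e u) (e v)) (e ⁻¹' V0) (e.symm v0) (fun u v => w0 (e u) (e v))
      (e ⁻¹' T0) (fun i u v => w i (e u) (e v)) (fun i => e ⁻¹' T i) k := by
  obtain ⟨σ, hσ, hπ⟩ := h
  have hhist : ∀ (π : ℕ → U) n, (histList π n).map e = histList (fun j => e (π j)) n := by
    intro π n
    simp [histList]
  refine ⟨fun l => e.symm (σ (l.map e)), ?_, ?_⟩
  · intro l u hl hu
    have h1 := hσ (l.map e) (e u) (by
      have h2 := (List.isChain_map (R := E) e (l := l ++ [u])).2 hl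
      rw [List.map_append] at h2
      exact h2) hu
    simpa using h1
  · intro π hp h0 hc hopt
    refine hπ (fun j => e (π j)) hp (by simp [h0]) ?_ ?_
    · intro j hj
      have := hc j hj
      simp only [hhist] at this
      simp [this]
    · rintro ⟨π', hp', h0', hc', hlt⟩
      refine hopt ⟨fun j => e.symm (π' j), fun j => by simpa using hp' j, by simp [h0'], ?_, ?_⟩
      · intro j hj
        simp only [hhist, Equiv.apply_symm_apply]
        rw [hc' j (by simpa using hj)]
      · change payZ w T (fun j => e (e.symm (π' j))) < payZ w T (fun j => e (π j))
        simpa using hlt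

theorem gamePositive_comap_iff {U V : Type*} {t : ℕ} {E : V → V → Prop}
    {V0 : Set V} {v0 : V} {w0 : V → V → ℤ} {T0 : Set V} {w : Fin t → V → V → ℤ}
    {T : Fin t → Set V} {k : ℕ} (e : U ≃ V) :
    GamePositive (fun u v => E (e u) (e v)) (e ⁻¹' V0) (e.symm v0) (fun u v => w0 (e u) (e v))
      (e ⁻¹' T0) (fun i u v => w i (e u) (e v)) (fun i => e ⁻¹' T i) k ↔
    GamePositive E V0 v0 w0 T0 w T k := by
  refine ⟨fun h => ?_, fun h => h.comap e⟩
  simpa [← Set.preimage_comp] using h.comap e.symm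

end CounterNet

namespace NCPSInstance

open CounterNet

section Lists

variable {M : ℕ}

/-- A relation on `Fin M` as a list of pairs. -/
noncomputable def edgeList (E : Fin M → Fin M → Prop) : List (ℕ × ℕ) :=
  (Finset.univ.filter fun p : Fin M × Fin M => E p.1 p.2).toList.map fun p => (↑p.1, ↑p.2)

/-- A subset of `Fin M` as a list. -/
noncomputable def vertexList (S : Set (Fin M)) : List ℕ :=
  (Finset.univ.filter fun v => v ∈ S).toList.map Fin.val

/-- A weight function on `Fin M` as a list of weighted edges. -/
noncomputable def weightList (f : Fin M → Fin M → ℤ) : List (ℕ × ℕ × ℤ) :=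
  (Finset.univ : Finset (Fin M × Fin M)).toList.map fun p => (↑p.1, ↑p.2, f p.1 p.2)

theorem mem_edgeList {E : Fin M → Fin M → Prop} {u v : Fin M} :
    ((u : ℕ), (v : ℕ)) ∈ edgeList E ↔ E u v := by
  simp only [edgeList, List.mem_map, Finset.mem_toList, Finset.mem_filter, Finset.mem_univ,
    true_and, Prod.exists, Prod.mk.injEq]
  constructor
  · rintro ⟨a, b, h, ha, hb⟩
    obtain rfl := Fin.ext ha
    obtain rfl := Fin.ext hb
    exact h
  · exact fun h => ⟨u, v, h, rfl, rfl⟩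

theorem mem_vertexList {S : Set (Fin M)} {v : Fin M} : (v : ℕ) ∈ vertexList S ↔ v ∈ S := by
  simp only [vertexList, List.mem_map, Finset.mem_toList, Finset.mem_filter, Finset.mem_univ,
    true_and]
  constructor
  · rintro ⟨a, h, ha⟩
    obtain rfl := Fin.ext ha
    exact h
  · exact fun h => ⟨v, h, rfl⟩

theorem weightOf_cons (a b : ℕ) (z : ℤ) (l : List (ℕ × ℕ × ℤ)) (u v : ℕ) :
    weightOf ((a, b, z) :: l) u v = (if a = u ∧ b = v then z else 0) + weightOf l u v := by
  by_cases h : a = u ∧ b = v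
  · simp [weightOf, h]
  · have h' : (a == u && b == v) = false := by simpa using h
    simp [weightOf, h, h']

theorem weightOf_eq_sum (l : List (ℕ × ℕ × ℤ)) (u v : ℕ) :
    weightOf l u v = (l.map fun p => if p.1 = u ∧ p.2.1 = v then p.2.2 else 0).sum := by
  induction l with
  | nil => rfl
  | cons p l ih =>
    obtain ⟨a, b, z⟩ := p
    rw [weightOf_cons, ih, List.map_cons, List.sum_cons]

theorem weightOf_weightList (f : Fin M → Fin M → ℤ) (u v : Fin M) :
    weightOf (weightList f) u v = f u v := by
  rw [weightOf_eq_sum, weightList, List.map_map, Finset.sum_map_toList,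
    Finset.sum_eq_single (u, v)]
  · simp
  · rintro ⟨a, b⟩ - hne
    have : ¬ ((a : ℕ) = u ∧ (b : ℕ) = v) := by
      rintro ⟨ha, hb⟩
      exact hne (by rw [Fin.ext ha, Fin.ext hb])
    simp [this]
  · simp

end Lists

/-- The enumeration of the dimensions of the game of a counter net. -/
def dimension : ℕ → Option (ℕ × Bool)
  | 0 => none
  | i + 1 => some (i / 2, i % 2 == 0)

theorem exists_dimension_eq {r R : ℕ} (hr : r < R) (s : Bool) :
    ∃ i : Fin (2 * R + 1), dimension i = some (r, s) := by
  cases s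
  · refine ⟨⟨2 * r + 2, by omega⟩, ?_⟩
    have h : (2 * r + 1) / 2 = r := by omega
    have h' : (2 * r + 1) % 2 = 1 := by omega
    simp [dimension, h, h']
  · refine ⟨⟨2 * r + 1, by omega⟩, ?_⟩
    simp [dimension]

/-- The initial counter values for the input `m`, which is stored in the counter `0`. -/
def inputCounters (m : ℕ) (r : ℕ) : ℤ := if r = 0 then m else 0

section OfNet

variable {Q : Type} {M : ℕ}

/-- The weights of dimension `d` for the input `0`. -/
noncomputable def netWeights (N : CounterNet Q) (q₀ : Q) (e : Vertex Q ≃ Fin M)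
    (d : Option (ℕ × Bool)) : List (ℕ × ℕ × ℤ) :=
  weightList fun u v => N.dimWeight (q₀, inputCounters 0) d (e.symm u) (e.symm v)

/-- The instance encoding the game of a counter net with counters below `R + 1` on the
input `m`. -/
noncomputable def ofNet (N : CounterNet Q) (q₀ : Q) (e : Vertex Q ≃ Fin M) (R m : ℕ) :
    NCPSInstance where
  n := M
  t := 2 * (R + 1) + 1
  edges := edgeList fun u v => N.GameEdge q₀ (e.symm u) (e.symm v)
  sys := vertexList (e.symm ⁻¹' stateSet)
  w0 := []
  w := netWeights N q₀ e none ::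
    (((e .start : ℕ), (e (.state q₀) : ℕ), (m : ℤ)) :: netWeights N q₀ e (some (0, true))) ::
    (((e .start : ℕ), (e (.state q₀) : ℕ), -(m : ℤ)) :: netWeights N q₀ e (some (0, false))) ::
    (List.range (2 * R)).map fun i => netWeights N q₀ e (dimension (i + 3))
  tgt0 := vertexList (e.symm ⁻¹' {.ref})
  tgt := (List.range (2 * (R + 1) + 1)).map fun i =>
    vertexList (e.symm ⁻¹' N.dimTarget (dimension i))
  v0 := e .start
  c := 0

variable (N : CounterNet Q) (q₀ : Q) (e : Vertex Q ≃ Fin M) (R m : ℕ)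

theorem exists_gameEdge (u : Vertex Q) : ∃ v, N.GameEdge q₀ u v := by
  cases u with
  | start => exact ⟨_, .start_ref⟩
  | ref => exact ⟨_, .ref⟩
  | state q => exact ⟨_, .choose q true⟩
  | choice q b => exact ⟨_, .halt q b⟩
  | halt q b => exact ⟨_, .stay q b⟩

theorem weightOf_netWeights (d : Option (ℕ × Bool)) (u v : Fin M) :
    weightOf (netWeights N q₀ e d) u v =
      N.dimWeight (q₀, inputCounters 0) d (e.symm u) (e.symm v) :=
  weightOf_weightList _ u v

theorem counterWeight_inputCounters (r : ℕ) (u v : Vertex Q) :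
    N.counterWeight (q₀, inputCounters m) r u v =
      (if u = .start ∧ v = .state q₀ then inputCounters m r else 0) +
        N.counterWeight (q₀, inputCounters 0) r u v := by
  have h0 : inputCounters 0 r = 0 := by simp [inputCounters]
  cases u <;> cases v <;> simp [counterWeight, h0]

theorem dimWeight_inputCounters {d : Option (ℕ × Bool)} (h : ∀ s, d ≠ some (0, s)) :
    N.dimWeight (q₀, inputCounters m) d = N.dimWeight (q₀, inputCounters 0) d := by
  funext u v
  rcases d with _ | ⟨r, s⟩
  · cases v <;> rfl
  · have hr : r ≠ 0 := by
      rintro rfl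
      exact h s rfl
    have hm : inputCounters m r = 0 := by simp [inputCounters, hr]
    cases s <;> simp [dimWeight, counterWeight_inputCounters N q₀ m, hm]

theorem weight_ofNet (i : Fin (2 * (R + 1) + 1)) (u v : Fin M) :
    (ofNet N q₀ e R m).weight i u v =
      N.dimWeight (q₀, inputCounters m) (dimension i) (e.symm u) (e.symm v) := by
  have hif : ∀ z : ℤ, (if (e .start : ℕ) = u ∧ (e (.state q₀) : ℕ) = v then z else 0) =
      if e.symm u = .start ∧ e.symm v = .state q₀ then z else 0 := by
    intro z
    refine if_congr ?_ rfl rfl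
    rw [← Fin.ext_iff, ← Fin.ext_iff, Equiv.symm_apply_eq, Equiv.symm_apply_eq, eq_comm,
      @eq_comm _ v]
  have hm : inputCounters m 0 = m := by simp [inputCounters]
  obtain ⟨i, hi⟩ := i
  change weightOf ((ofNet N q₀ e R m).w.getD i []) u v = _
  simp only [ofNet]
  match i with
  | 0 =>
    rw [dimWeight_inputCounters N q₀ m (by simp [dimension])]
    exact weightOf_netWeights N q₀ e none u v
  | 1 =>
    change weightOf ((_, _, _) :: _) _ _ = N.counterWeight (q₀, inputCounters m) 0 _ _
    rw [weightOf_cons, hif, weightOf_netWeights, counterWeight_inputCounters N q₀ m, hm]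
    rfl
  | 2 =>
    change weightOf ((_, _, _) :: _) _ _ = -N.counterWeight (q₀, inputCounters m) 0 _ _
    rw [weightOf_cons, hif, weightOf_netWeights, counterWeight_inputCounters N q₀ m, hm, neg_add]
    split_ifs <;> simp [dimWeight]
  | i + 3 =>
    rw [dimWeight_inputCounters N q₀ m]
    · rw [← weightOf_netWeights]
      simp [List.getD, show i < 2 * R by omega]
    · intro s h
      simp only [dimension, Option.some.injEq, Prod.mk.injEq] at h
      omega

theorem target_ofNet (i : Fin (2 * (R + 1) + 1)) :
    (ofNet N q₀ e R m).target i = e.symm ⁻¹' N.dimTarget (dimension i) := by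
  ext v
  change (v : ℕ) ∈ (ofNet N q₀ e R m).tgt.getD i [] ↔ _
  have h : (ofNet N q₀ e R m).tgt.getD i [] =
      vertexList (e.symm ⁻¹' N.dimTarget (dimension i)) := by
    simp [ofNet, List.getD, i.2]
  rw [h]
  exact mem_vertexList

theorem positive_ofNet_iff (hR : ∀ q b, N.reg q b < R + 1) :
    (ofNet N q₀ e R m).Positive ↔ N.HasLegalRun (q₀, inputCounters m) := by
  have hE : (ofNet N q₀ e R m).Edge = fun u v : Fin M => N.GameEdge q₀ (e.symm u) (e.symm v) := by
    funext u v
    exact propext (mem_edgeList (E := fun u v : Fin M => N.GameEdge q₀ (e.symm u) (e.symm v)))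
  have hS : (ofNet N q₀ e R m).sysSet = e.symm ⁻¹' stateSet := Set.ext fun v => mem_vertexList
  have hT0 : (ofNet N q₀ e R m).target0 = e.symm ⁻¹' {.ref} := Set.ext fun v => mem_vertexList
  have hw : (ofNet N q₀ e R m).weight = fun (i : Fin (2 * (R + 1) + 1)) (u v : Fin M) =>
      N.dimWeight (q₀, inputCounters m) (dimension i) (e.symm u) (e.symm v) := by
    funext i u v
    exact weight_ofNet N q₀ e R m i u v
  have hT : (ofNet N q₀ e R m).target = fun i : Fin (2 * (R + 1) + 1) =>
      e.symm ⁻¹' N.dimTarget (dimension i) := by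
    funext i
    exact target_ofNet N q₀ e R m i
  have hw0 : (ofNet N q₀ e R m).weight0 = fun _ _ : Fin M => 0 := rfl
  rw [← N.gamePositive_iff_hasLegalRun (q₀, inputCounters m)
    (fun i : Fin (2 * (R + 1) + 1) => dimension i) ⟨0, rfl⟩
    (fun q b s => exists_dimension_eq (hR q b) s), ← gamePositive_comap_iff e.symm]
  have h0 : (ofNet N q₀ e R m).v0 < (ofNet N q₀ e R m).n := (e .start).2
  have hsucc : ∀ u : Fin (ofNet N q₀ e R m).n, ∃ v, (ofNet N q₀ e R m).Edge u v := by
    intro u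
    obtain ⟨v, hv⟩ := exists_gameEdge N q₀ (e.symm u)
    rw [hE]
    exact ⟨e v, by simpa using hv⟩
  have key : (ofNet N q₀ e R m).Positive ↔ GamePositive (ofNet N q₀ e R m).Edge
      (ofNet N q₀ e R m).sysSet ⟨(ofNet N q₀ e R m).v0, h0⟩ (ofNet N q₀ e R m).weight0
      (ofNet N q₀ e R m).target0 (ofNet N q₀ e R m).weight (ofNet N q₀ e R m).target
      (ofNet N q₀ e R m).c :=
    ⟨fun ⟨_, _, h⟩ => h, fun h => ⟨h0, hsucc, h⟩⟩
  rw [key, hE, hS, hT0, hw, hT, hw0]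
  rfl

end OfNet

theorem primrec_natCast_int : Primrec fun m : ℕ => (m : ℤ) := by
  rw [← Primrec.encode_iff]
  refine (Primrec.nat_mul.comp (.const 2) .id).of_eq fun m => ?_
  rfl

theorem primrec_neg_natCast_int : Primrec fun m : ℕ => -(m : ℤ) := by
  rw [← Primrec.encode_iff]
  refine (Primrec.nat_sub.comp (Primrec.nat_mul.comp (.const 2) .id) (.const 1)).of_eq fun m => ?_
  rcases m with _ | m
  · rfl
  · rfl

theorem primrec_ofNet {Q : Type} {M : ℕ} (N : CounterNet Q) (q₀ : Q) (e : Vertex Q ≃ Fin M)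
    (R : ℕ) : Primrec (ofNet N q₀ e R) := by
  have hcons : ∀ (a b : ℕ) (l : List (ℕ × ℕ × ℤ)) {f : ℕ → ℤ}, Primrec f →
      Primrec fun m => (a, b, f m) :: l := fun a b l f hf =>
    Primrec.list_cons.comp (Primrec.pair (.const a) (Primrec.pair (.const b) hf)) (.const l)
  have hw : Primrec fun m => (ofNet N q₀ e R m).w :=
    Primrec.list_cons.comp (.const _) (Primrec.list_cons.comp
      (hcons _ _ _ primrec_natCast_int) (Primrec.list_cons.comp
        (hcons _ _ _ primrec_neg_natCast_int) (.const _)))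
  have h : Primrec fun m => encEquiv (ofNet N q₀ e R m) :=
    Primrec.pair (.const _) (Primrec.pair (.const _) (Primrec.pair (.const _)
      (Primrec.pair (.const _) (Primrec.pair (.const _) (Primrec.pair hw
        (Primrec.pair (.const _) (Primrec.pair (.const _) (Primrec.pair (.const _)
          (.const _)))))))))
  exact (Primrec.of_equiv_iff encEquiv).1 h

end NCPSInstance

namespace CounterNet

instance finite_vertex (Q : Type) [Finite Q] : Finite (Vertex Q) := by
  let f : Vertex Q → Option (Option (Q ⊕ (Q × Bool) ⊕ (Q × Bool)))
    | .start => none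
    | .ref => some none
    | .state q => some (some (.inl q))
    | .choice q b => some (some (.inr (.inl (q, b))))
    | .halt q b => some (some (.inr (.inr (q, b))))
  refine Finite.of_injective f fun u v h => ?_
  cases u <;> cases v <;> simp_all [f]

/-- The existence of legal runs of a finite counter net reduces to positivity of instances. -/
theorem exists_primrec_positive_iff {Q : Type} [Finite Q] (N : CounterNet Q) (q₀ : Q) :
    ∃ I : ℕ → NCPSInstance, Primrec I ∧
      ∀ m, (I m).Positive ↔ N.HasLegalRun (q₀, NCPSInstance.inputCounters m) := by
  obtain ⟨M, ⟨e⟩⟩ := Finite.exists_equiv_fin (Vertex Q)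
  obtain ⟨R, hR⟩ := (Set.finite_range fun p : Q × Bool => N.reg p.1 p.2).bddAbove
  exact ⟨NCPSInstance.ofNet N q₀ e R, NCPSInstance.primrec_ofNet N q₀ e R, fun m =>
    NCPSInstance.positive_ofNet_iff N q₀ e R m fun q b => Nat.lt_succ_of_le (hR ⟨(q, b), rfl⟩)⟩

end CounterNet

/-- The vanishing of the values of a partial recursive function on its domain reduces to
positivity of instances. -/
theorem Nat.Partrec.exists_primrec_positive_iff {f : ℕ →. ℕ} (hf : Nat.Partrec f) :
    ∃ I : ℕ → NCPSInstance, Primrec I ∧ ∀ n, ∀ y ∈ f n, (I n).Positive ↔ y = 0 := by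
  obtain ⟨p, hp⟩ := CounterProg.computes_of_partrec'
    (Nat.Partrec'.part_iff₁.2 (Partrec.nat_iff.2 hf)) (fun _ => 0) 1 2 (by simp) (by simp)
    (by simp)
  have : Finite (CounterProg.stackSet p) :=
    ((CounterProg.finite_support p []).insert []).to_subtype
  obtain ⟨I, hI, hpos⟩ := (CounterProg.net.restrict _
    (CounterProg.next_mem_stackSet p)).exists_primrec_positive_iff
      ⟨[p], Or.inr (CounterProg.cons_mem_support p [])⟩
  refine ⟨I, hI, fun n y hy => ?_⟩
  let s : ℕ → ℕ := fun r => if r = 0 then n else 0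
  have hs : NCPSInstance.inputCounters n = fun r => (s r : ℤ) := by
    funext r
    by_cases hr : r = 0 <;> simp [NCPSInstance.inputCounters, s, hr]
  have hexec := hp s (fun r hr => if_neg (by omega)) rfl y hy
  rw [hpos, CounterNet.hasLegalRun_restrict, hs, hexec.hasLegalRun_iff]
  simp

/-- The non-cooperative Pareto rational synthesis problem for quantitative
reachability games with integer weights is undecidable: the set of positive
instances is not a computable (decidable) set. -/
theorem NCPS_undecidable : ¬ ComputablePred NCPSInstance.Positive := by
  intro h
  have hf : Nat.Partrec fun n => (Nat.Partrec.Code.ofNatCode n).eval n :=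
    Partrec.nat_iff.1 (Nat.Partrec.Code.eval_part.comp (Computable.ofNat Nat.Partrec.Code) .id)
  obtain ⟨I, hI, hpos⟩ := hf.exists_primrec_positive_iff
  obtain ⟨_, hdec⟩ := h
  have hd : Computable fun n => (decide (I n).Positive).toNat :=
    (Primrec.dom_finite Bool.toNat).to_comp.comp (hdec.comp hI.to_comp)
  obtain ⟨c, hc⟩ := Nat.Partrec.Code.exists_code.1 (Partrec.nat_iff.1 hd.partrec)
  have hmem : (decide (I (Encodable.encode c)).Positive).toNat ∈
      (Nat.Partrec.Code.ofNatCode (Encodable.encode c)).eval (Encodable.encode c) := by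
    have : Nat.Partrec.Code.ofNatCode (Encodable.encode c) = c := Denumerable.ofNat_encode c
    rw [this, hc]
    simp
  have := hpos _ _ hmem
  by_cases hP : (I (Encodable.encode c)).Positive <;> simp [hP] at this
end
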